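/- arXiv:1404.0608 — 4 statements merged into one kernel-verified Lean document; each statement's English description precedes it below -/
import Mathlib

section
/- Let r > 0, d > 0 with 81d² > 48r², let n₂, n₃ be integers greater than 1, and let a, ℓ be real numbers with ℓ ≠ 0. Set Γ = (9d + √(81d² − 48r²))^{1/3} and y₀⁰ = (2/3)·(36r)^{1/3}/Γ + (1/3)·(6/r)^{1/3}·Γ. Then there exists ε₀ > 0 such that for every ε ∈ (0, ε₀) the system ẋ = y, ẏ = −x + εr y − εr x² y − ε^{n₂} a x³ − ε^{n₃} ℓ x⁵ + εd cos t has a 2π-periodic solution (x(t,ε), y(t,ε)), and these solutions can be chosen so that (x(0,ε), y(0,ε)) → (0, y₀⁰) as ε → 0⁺. -/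
noncomputable section

namespace DuffingVanDerPol

open Real

instance fact_two_pi_pos : Fact (0 < 2 * π) := ⟨two_pi_pos⟩

/-- The Banach algebra of continuous `2π`-periodic functions. -/
abbrev Periodic : Type := C(AddCircle (2 * π), ℝ)

/-- The cosine as a periodic function. -/
def cosP : Periodic := ⟨Angle.cos, Angle.continuous_cos⟩

/-- The sine as a periodic function. -/
def sinP : Periodic := ⟨Angle.sin, Angle.continuous_sin⟩

@[simp] lemma cosP_coe (t : ℝ) : cosP (t : AddCircle (2 * π)) = cos t := rfl

@[simp] lemma sinP_coe (t : ℝ) : sinP (t : AddCircle (2 * π)) = sin t := rfl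

lemma continuous_coe_comp (f : Periodic) : Continuous fun t : ℝ => f (t : AddCircle (2 * π)) :=
  f.continuous.comp (AddCircle.continuous_mk' _)

lemma intervalIntegrable_coe (f : Periodic) (a b : ℝ) :
    IntervalIntegrable (fun t : ℝ => f (t : AddCircle (2 * π))) MeasureTheory.volume a b :=
  (continuous_coe_comp f).intervalIntegrable a b

lemma norm_integral_coe_le (f : Periodic) (t : ℝ) :
    ‖∫ s in (0 : ℝ)..t, f (s : AddCircle (2 * π))‖ ≤ ‖f‖ * |t| := by
  simpa using intervalIntegral.norm_integral_le_of_norm_le_const (a := 0) (b := t)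
    (fun s _ => f.norm_coe_le_norm (s : AddCircle (2 * π)))

/-- The integral over one period. -/
def period : Periodic →L[ℝ] ℝ :=
  LinearMap.mkContinuous
    { toFun := fun f => ∫ s in (0 : ℝ)..(2 * π), f (s : AddCircle (2 * π))
      map_add' := fun f g => by
        simpa using intervalIntegral.integral_add (intervalIntegrable_coe f _ _)
          (intervalIntegrable_coe g _ _)
      map_smul' := fun k f => by simp }
    (2 * π) (fun f => by
      have h := norm_integral_coe_le f (2 * π)
      exact h.trans_eq (by rw [abs_of_pos two_pi_pos, mul_comm]))

lemma period_apply (f : Periodic) :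
    period f = ∫ s in (0 : ℝ)..(2 * π), f (s : AddCircle (2 * π)) := rfl

/-- The primitive vanishing at `0` of the mean-free part of `f`, as a function on the line. -/
def primitiveFun (f : Periodic) (t : ℝ) : ℝ :=
  (∫ s in (0 : ℝ)..t, f (s : AddCircle (2 * π))) - t / (2 * π) * period f

lemma primitiveFun_periodic (f : Periodic) : Function.Periodic (primitiveFun f) (2 * π) := by
  intro t
  have hper : Function.Periodic (fun s : ℝ => f (s : AddCircle (2 * π))) (2 * π) := fun s => by
    simp only [AddCircle.coe_add_period]
  have h := intervalIntegral.integral_add_adjacent_intervals (intervalIntegrable_coe f 0 t)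
    (intervalIntegrable_coe f t (t + 2 * π))
  rw [hper.intervalIntegral_add_eq t 0, zero_add, ← period_apply] at h
  have hpi : (2 * π) ≠ 0 := two_pi_pos.ne'
  simp only [primitiveFun, ← h]
  field_simp
  ring

lemma continuous_primitiveFun (f : Periodic) : Continuous (primitiveFun f) := by
  have h := intervalIntegral.continuous_primitive (fun a b => intervalIntegrable_coe f a b) 0
  unfold primitiveFun
  fun_prop

/-- The primitive vanishing at `0` of the mean-free part of a periodic function. -/
def primitive : Periodic →L[ℝ] Periodic :=
  LinearMap.mkContinuous
    { toFun := fun f => ⟨(primitiveFun_periodic f).lift,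
        continuous_coinduced_dom.mpr (continuous_primitiveFun f)⟩
      map_add' := fun f g => by
        ext x
        induction x using QuotientAddGroup.induction_on with | H t =>
        have h := intervalIntegral.integral_add (intervalIntegrable_coe f 0 t)
          (intervalIntegrable_coe g 0 t)
        simp only [ContinuousMap.coe_mk, ContinuousMap.add_apply, Function.Periodic.lift_coe,
          primitiveFun, h, map_add]
        ring
      map_smul' := fun k f => by
        ext x
        induction x using QuotientAddGroup.induction_on with | H t =>
        simp only [ContinuousMap.coe_mk, ContinuousMap.smul_apply, Function.Periodic.lift_coe,
          primitiveFun, map_smul, smul_eq_mul, intervalIntegral.integral_const_mul, RingHom.id_apply]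
        ring }
    (2 * π + ‖period‖) (fun f => by
      refine (ContinuousMap.norm_le _ (by positivity)).mpr fun x => ?_
      obtain ⟨t, ht, rfl⟩ := (AddCircle.eq_coe_Ico x)
      have h0 := norm_integral_coe_le f t
      have h1 := period.le_opNorm f
      have h2 : ‖t / (2 * π)‖ ≤ 1 := by
        rw [norm_of_nonneg (div_nonneg ht.1 two_pi_pos.le), div_le_one two_pi_pos]
        exact ht.2.le
      have h3 : ‖f‖ * |t| ≤ ‖f‖ * (2 * π) := by
        rw [abs_of_nonneg ht.1]
        exact mul_le_mul_of_nonneg_left ht.2.le (norm_nonneg _)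
      have h4 : ‖t / (2 * π) * period f‖ ≤ ‖period‖ * ‖f‖ := by
        rw [norm_mul]
        exact (mul_le_of_le_one_left (norm_nonneg _) h2).trans h1
      change ‖primitiveFun f t‖ ≤ _
      exact (norm_sub_le _ _).trans (by linarith))

lemma primitive_coe (f : Periodic) (t : ℝ) :
    primitive f (t : AddCircle (2 * π)) =
      (∫ s in (0 : ℝ)..t, f (s : AddCircle (2 * π))) - t / (2 * π) * period f := rfl

/-- Evaluation at `0`. -/
def evalZero : Periodic →L[ℝ] ℝ := ContinuousMap.evalCLM ℝ ((0 : ℝ) : AddCircle (2 * π))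

lemma evalZero_apply (f : Periodic) : evalZero f = f ((0 : ℝ) : AddCircle (2 * π)) := rfl

@[simp] lemma evalZero_one : evalZero 1 = 1 := rfl

@[simp] lemma evalZero_cosP : evalZero cosP = 1 := cos_zero

@[simp] lemma evalZero_sinP : evalZero sinP = 0 := sin_zero

@[simp] lemma evalZero_primitive (f : Periodic) : evalZero (primitive f) = 0 := by
  rw [evalZero_apply, primitive_coe]
  simp

/-- The first coordinate of the solution attached to the rotating coordinates `u`. -/
def position : Periodic × Periodic →L[ℝ] Periodic :=
  (ContinuousLinearMap.mul ℝ Periodic cosP) ∘L .fst ℝ Periodic Periodic +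
    (ContinuousLinearMap.mul ℝ Periodic sinP) ∘L .snd ℝ Periodic Periodic

/-- The second coordinate of the solution attached to the rotating coordinates `u`. -/
def velocity : Periodic × Periodic →L[ℝ] Periodic :=
  (ContinuousLinearMap.mul ℝ Periodic cosP) ∘L .snd ℝ Periodic Periodic -
    (ContinuousLinearMap.mul ℝ Periodic sinP) ∘L .fst ℝ Periodic Periodic

lemma position_apply (u : Periodic × Periodic) : position u = cosP * u.1 + sinP * u.2 := rfl

lemma velocity_apply (u : Periodic × Periodic) : velocity u = cosP * u.2 - sinP * u.1 := rfl

/-- The perturbing force divided by `ε`, along `u`. -/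
def force (r d a l : ℝ) (m k : ℕ) (ε : ℝ) (u : Periodic × Periodic) : Periodic :=
  r • velocity u - r • (position u * position u * velocity u)
    - (ε ^ (m + 1) * a) • position u ^ 3 - (ε ^ (k + 1) * l) • position u ^ 5 + d • cosP

/-- The operator whose zeros satisfy `p = p 0 + ε ∫ f` with `f` of zero mean. -/
def residual (ε : ℝ) (p f : Periodic) : Periodic :=
  p - evalZero p • 1 - ε • primitive f + period f • 1

/-- The operator whose zeros are the periodic solutions in rotating coordinates. -/
def periodicOperator (r d a l : ℝ) (m k : ℕ) (z : ℝ × (Periodic × Periodic)) :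
    Periodic × Periodic :=
  (residual z.1 z.2.1 (-sinP * force r d a l m k z.1 z.2),
    residual z.1 z.2.2 (cosP * force r d a l m k z.1 z.2))

lemma contDiff_periodicOperator (r d a l : ℝ) (m k : ℕ) :
    ContDiff ℝ 1 (periodicOperator r d a l m k) := by
  unfold periodicOperator residual force
  fun_prop

lemma period_eq_zero_of_residual {ε : ℝ} {p f : Periodic} (h : residual ε p f = 0) :
    period f = 0 := by
  have h0 := congrArg evalZero h
  simpa [residual] using h0

lemma hasDerivAt_of_residual {ε : ℝ} {p f : Periodic} (h : residual ε p f = 0) (t : ℝ) :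
    HasDerivAt (fun s : ℝ => p (s : AddCircle (2 * π))) (ε * f (t : AddCircle (2 * π))) t := by
  have hp : ∀ s : ℝ, p (s : AddCircle (2 * π)) =
      evalZero p + ε * ∫ x in (0 : ℝ)..s, f (x : AddCircle (2 * π)) := fun s => by
    have hs := congrArg (fun g : Periodic => g (s : AddCircle (2 * π))) h
    simp only [residual, period_eq_zero_of_residual h, ContinuousMap.add_apply,
      ContinuousMap.sub_apply, ContinuousMap.smul_apply, ContinuousMap.one_apply,
      ContinuousMap.zero_apply, primitive_coe, smul_eq_mul] at hs
    linarith
  simp only [hp]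
  exact ((intervalIntegral.integral_hasDerivAt_right (intervalIntegrable_coe f 0 t)
    ((continuous_coe_comp f).stronglyMeasurableAtFilter _ _)
    (continuous_coe_comp f).continuousAt).const_mul ε).const_add _

lemma period_eq_of_trigonometric (f : Periodic) (a₁ a₂ a₃ a₄ a₅ a₆ : ℝ)
    (hf : ∀ t : ℝ, f (t : AddCircle (2 * π)) =
      a₁ * sin t ^ 2 + a₂ * (sin t * cos t) + a₃ * cos t ^ 2 + a₄ * sin t ^ 4
        + a₅ * (sin t ^ 3 * cos t) + a₆ * (sin t ^ 2 * cos t ^ 2)) :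
    period f = π * (a₁ + a₃ + 3 / 4 * a₄ + a₆ / 4) := by
  let F : ℝ → ℝ := fun t =>
    a₁ * ((t - sin t * cos t) / 2) + a₂ * (sin t ^ 2 / 2) + a₃ * ((t + sin t * cos t) / 2)
      + a₄ * (3 / 8 * (t - sin t * cos t) - sin t ^ 3 * cos t / 4) + a₅ * (sin t ^ 4 / 4)
      + a₆ * ((t - sin t * cos t) / 8 + sin t ^ 3 * cos t / 4)
  have hF : ∀ t ∈ Set.uIcc 0 (2 * π), HasDerivAt F (f (t : AddCircle (2 * π))) t := by
    intro t _
    have hs := hasDerivAt_sin t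
    have hc := hasDerivAt_cos t
    have hsc := hs.mul hc
    have h3 := (hs.pow 3).mul hc
    have ht := hasDerivAt_id t
    have h := (((((((ht.sub hsc).div_const 2).const_mul a₁).add
      (((hs.pow 2).div_const 2).const_mul a₂)).add
      (((ht.add hsc).div_const 2).const_mul a₃)).add
      ((((ht.sub hsc).const_mul (3 / 8)).sub (h3.div_const 4)).const_mul a₄)).add
      (((hs.pow 4).div_const 4).const_mul a₅)).add
      ((((ht.sub hsc).div_const 8).add (h3.div_const 4)).const_mul a₆)
    refine HasDerivAt.congr_deriv (f := F) h ?_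
    rw [hf]
    have h1 : cos t ^ 2 = 1 - sin t ^ 2 := cos_sq' t
    have h2 : cos t * cos t = 1 - sin t ^ 2 := by rw [← sq, h1]
    simp only [Pi.pow_apply, mul_assoc, h1, h2]
    push_cast
    ring
  rw [period_apply, intervalIntegral.integral_eq_sub_of_hasDerivAt hF
    (intervalIntegrable_coe f _ _)]
  simp [F]
  ring

/-- The initial point in rotating coordinates, for the unperturbed solution `y (sin, cos)`. -/
def basePoint (y : ℝ) : Periodic × Periodic := (0, y • 1)

lemma position_basePoint (y : ℝ) : position (basePoint y) = y • sinP := by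
  simp [position_apply, basePoint]

lemma velocity_basePoint (y : ℝ) : velocity (basePoint y) = y • cosP := by
  simp [velocity_apply, basePoint]

lemma force_zero (r d a l : ℝ) (m k : ℕ) (u : Periodic × Periodic) :
    force r d a l m k 0 u =
      r • velocity u - r • (position u * position u * velocity u) + d • cosP := by
  simp [force]

lemma periodicOperator_basePoint {r d a l : ℝ} {m k : ℕ} {y : ℝ}
    (hy : r * y - r * y ^ 3 / 4 + d = 0) :
    periodicOperator r d a l m k (0, basePoint y) = 0 := by
  have h1 : period (-sinP * force r d a l m k 0 (basePoint y)) = 0 := by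
    rw [period_eq_of_trigonometric _ 0 (-(r * y + d)) 0 0 (r * y ^ 3) 0]
    · simp
    · intro t
      simp [force_zero, position_basePoint, velocity_basePoint]
      ring
  have h2 : period (cosP * force r d a l m k 0 (basePoint y)) = 0 := by
    rw [period_eq_of_trigonometric _ 0 0 (r * y + d) 0 0 (-(r * y ^ 3))]
    · linear_combination π * hy
    · intro t
      simp [force_zero, position_basePoint, velocity_basePoint]
      ring
  simp only [periodicOperator, residual, h1, h2]
  simp [basePoint]

/-- The derivative of the force at `ε = 0` and at `basePoint y`. -/
def linearForce (r y : ℝ) : Periodic × Periodic →L[ℝ] Periodic :=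
  r • velocity - (r * y ^ 2) •
    ((ContinuousLinearMap.mul ℝ Periodic ((2 : ℝ) • (sinP * cosP))) ∘L position +
      (ContinuousLinearMap.mul ℝ Periodic (sinP * sinP)) ∘L velocity)

lemma linearForce_apply (r y : ℝ) (h : Periodic × Periodic) :
    linearForce r y h = r • velocity h - (r * y ^ 2) •
      ((2 : ℝ) • (sinP * cosP) * position h + sinP * sinP * velocity h) := rfl

lemma hasFDerivAt_force_zero (r d a l : ℝ) (m k : ℕ) (y : ℝ) :
    HasFDerivAt (force r d a l m k 0) (linearForce r y) (basePoint y) := by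
  have hX := position.hasFDerivAt (x := basePoint y)
  have hV := velocity.hasFDerivAt (x := basePoint y)
  have h := ((hV.const_smul r).sub (((hX.mul hX).mul hV).const_smul r)).add_const (d • cosP)
  refine (h.congr_of_eventuallyEq (.of_forall fun u => force_zero r d a l m k u)).congr_fderiv ?_
  refine ContinuousLinearMap.ext fun v => ContinuousMap.ext fun t => ?_
  simp [linearForce_apply, position_basePoint, velocity_basePoint]
  ring

lemma hasFDerivAt_residual_zero {p f : Periodic × Periodic → Periodic}
    {p' f' : Periodic × Periodic →L[ℝ] Periodic} {u : Periodic × Periodic}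
    (hp : HasFDerivAt p p' u) (hf : HasFDerivAt f f' u) :
    HasFDerivAt (fun v => residual 0 (p v) (f v))
      (p' - (evalZero ∘L p').smulRight 1 + (period ∘L f').smulRight 1) u := by
  have h1 := (evalZero.hasFDerivAt.comp u hp).smul_const (1 : Periodic)
  have h2 := (period.hasFDerivAt.comp u hf).smul_const (1 : Periodic)
  refine ((hp.sub h1).add h2).congr_of_eventuallyEq (.of_forall fun v => ?_)
  simp [residual]

lemma bijective_of_residual_form {D : Periodic × Periodic →L[ℝ] Periodic × Periodic}
    {φ ψ : Periodic × Periodic →L[ℝ] ℝ} {A B : ℝ} (hA : A ≠ 0) (hB : B ≠ 0)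
    (hD : ∀ h, D h = (h.1 - evalZero h.1 • 1 + φ h • 1, h.2 - evalZero h.2 • 1 + ψ h • 1))
    (hφ : ∀ α β : ℝ, φ (α • 1, β • 1) = A * α) (hψ : ∀ α β : ℝ, ψ (α • 1, β • 1) = B * β) :
    Function.Bijective D := by
  constructor
  · refine (injective_iff_map_eq_zero D).mpr fun h h0 => ?_
    rw [hD, Prod.mk_eq_zero] at h0
    have e1 : φ h = 0 := by simpa using congrArg evalZero h0.1
    have e2 : ψ h = 0 := by simpa using congrArg evalZero h0.2
    rw [e1, e2] at h0
    have e3 : h.1 = evalZero h.1 • 1 := by simpa [sub_eq_zero] using h0.1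
    have e4 : h.2 = evalZero h.2 • 1 := by simpa [sub_eq_zero] using h0.2
    have e5 : h = (evalZero h.1 • 1, evalZero h.2 • 1) := Prod.ext e3 e4
    have e6 : evalZero h.1 = 0 := by
      have := hφ (evalZero h.1) (evalZero h.2)
      rw [← e5, e1] at this
      simpa [hA] using this.symm
    have e7 : evalZero h.2 = 0 := by
      have := hψ (evalZero h.1) (evalZero h.2)
      rw [← e5, e2] at this
      simpa [hB] using this.symm
    rw [e5, e6, e7]
    simp
  · intro g
    refine ⟨g + (((evalZero g.1 - φ g) / A) • 1, ((evalZero g.2 - ψ g) / B) • 1), ?_⟩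
    rw [hD, map_add, map_add, hφ, hψ]
    refine Prod.ext ?_ ?_
    · ext t
      simp
      field_simp
      ring
    · ext t
      simp
      field_simp
      ring

lemma isInvertible_fderiv_periodicOperator {r d a l : ℝ} {m k : ℕ} {y : ℝ} (hr : r ≠ 0)
    (h1 : 1 - y ^ 2 / 4 ≠ 0) (h3 : 1 - 3 * y ^ 2 / 4 ≠ 0) :
    (fderiv ℝ (periodicOperator r d a l m k) (0, basePoint y) ∘L
      .inr ℝ ℝ (Periodic × Periodic)).IsInvertible := by
  have hΨ : HasFDerivAt (periodicOperator r d a l m k)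
      (fderiv ℝ (periodicOperator r d a l m k) (0, basePoint y)) (0, basePoint y) :=
    ((contDiff_periodicOperator r d a l m k).differentiable one_ne_zero _).hasFDerivAt
  have hpart := hΨ.comp (basePoint y) (hasFDerivAt_prodMk_right (0 : ℝ) (basePoint y))
  have hF := hasFDerivAt_force_zero r d a l m k y
  have hexpl := (hasFDerivAt_residual_zero hasFDerivAt_fst (hF.const_mul (-sinP))).prodMk
    (hasFDerivAt_residual_zero hasFDerivAt_snd (hF.const_mul cosP))
  rw [hpart.unique hexpl]
  set D := _
  change ContinuousLinearMap.IsInvertible D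
  have hbij : Function.Bijective D := by
    refine bijective_of_residual_form
      (φ := period ∘L (-sinP • linearForce r y)) (ψ := period ∘L (cosP • linearForce r y))
      (A := π * r * (1 - y ^ 2 / 4)) (B := π * r * (1 - 3 * y ^ 2 / 4))
      (by positivity) (by positivity) (fun h => rfl) (fun α β => ?_) (fun α β => ?_)
    · change period (-sinP * linearForce r y (α • 1, β • 1)) = _
      rw [period_eq_of_trigonometric _ (r * α) (-(r * β)) 0 (-(r * y ^ 2 * α))
        (3 * (r * y ^ 2 * β)) (2 * (r * y ^ 2 * α))]
      · ring
      · intro t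
        simp [linearForce_apply, position_apply, velocity_apply]
        ring
    · change period (cosP * linearForce r y (α • 1, β • 1)) = _
      rw [period_eq_of_trigonometric _ 0 (-(r * α + 2 * (r * y ^ 2 * α))) (r * β)
        0 (3 * (r * y ^ 2 * α)) (-(3 * (r * y ^ 2 * β)))]
      · ring
      · intro t
        simp [linearForce_apply, position_apply, velocity_apply]
        linear_combination
          (-(2 * (r * y ^ 2 * α)) * sin t * cos t) * sin_sq_add_cos_sq t
  exact ⟨.ofBijective D (LinearMap.ker_eq_bot.mpr hbij.1) (LinearMap.range_eq_top.mpr hbij.2),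
    ContinuousLinearEquiv.coe_ofBijective ..⟩

lemma hasDerivAt_position {r d a l : ℝ} {m k : ℕ} {ε : ℝ} {u : Periodic × Periodic}
    (hu : periodicOperator r d a l m k (ε, u) = 0) (t : ℝ) :
    HasDerivAt (fun s : ℝ => position u (s : AddCircle (2 * π)))
      (velocity u (t : AddCircle (2 * π))) t := by
  rw [periodicOperator, Prod.mk_eq_zero] at hu
  have h := ((hasDerivAt_cos t).mul (hasDerivAt_of_residual hu.1 t)).add
    ((hasDerivAt_sin t).mul (hasDerivAt_of_residual hu.2 t))
  refine h.congr_deriv ?_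
  simp [velocity_apply]
  ring

lemma hasDerivAt_velocity {r d a l : ℝ} {m k : ℕ} {ε : ℝ} {u : Periodic × Periodic}
    (hu : periodicOperator r d a l m k (ε, u) = 0) (t : ℝ) :
    HasDerivAt (fun s : ℝ => velocity u (s : AddCircle (2 * π)))
      (-(position u (t : AddCircle (2 * π)))
        + ε * force r d a l m k ε u (t : AddCircle (2 * π))) t := by
  rw [periodicOperator, Prod.mk_eq_zero] at hu
  have h := ((hasDerivAt_cos t).mul (hasDerivAt_of_residual hu.2 t)).sub
    ((hasDerivAt_sin t).mul (hasDerivAt_of_residual hu.1 t))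
  refine h.congr_deriv ?_
  simp [position_apply]
  linear_combination
    (ε * force r d a l m k ε u (t : AddCircle (2 * π))) * sin_sq_add_cos_sq t

/-- The positive root of the averaged amplitude equation, by Cardano's formula. -/
def amplitude (r d : ℝ) : ℝ :=
  2 / 3 * (36 * r) ^ ((1 : ℝ) / 3) / ((9 * d + √(81 * d ^ 2 - 48 * r ^ 2)) ^ ((1 : ℝ) / 3))
    + 1 / 3 * (6 / r) ^ ((1 : ℝ) / 3) * ((9 * d + √(81 * d ^ 2 - 48 * r ^ 2)) ^ ((1 : ℝ) / 3))

lemma amplitude_pos {r d : ℝ} (hr : 0 < r) (hd : 0 < d) : 0 < amplitude r d := by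
  unfold amplitude
  positivity

lemma amplitude_root {r d : ℝ} (hr : 0 < r) (hd : 0 < d) (hrd : 48 * r ^ 2 < 81 * d ^ 2) :
    r * amplitude r d - r * amplitude r d ^ 3 / 4 + d = 0 := by
  have cube : ∀ x : ℝ, 0 < x → (x ^ ((1 : ℝ) / 3)) ^ 3 = x := fun x hx => by
    rw [← rpow_natCast, ← rpow_mul hx.le]
    norm_num
  set S := √(81 * d ^ 2 - 48 * r ^ 2)
  have hS0 : 0 ≤ S := sqrt_nonneg _
  have hS2 : S ^ 2 = 81 * d ^ 2 - 48 * r ^ 2 := sq_sqrt (by linarith)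
  set G := (9 * d + S) ^ ((1 : ℝ) / 3)
  set p := (36 * r) ^ ((1 : ℝ) / 3) with hp
  set q := (6 / r) ^ ((1 : ℝ) / 3) with hq
  have hGp : 0 < G := rpow_pos_of_pos (by positivity) _
  have hG3 : G ^ 3 = 9 * d + S := cube _ (by positivity)
  have hp3 : p ^ 3 = 36 * r := cube _ (by positivity)
  have hq3 : q ^ 3 = 6 / r := cube _ (by positivity)
  have hpq : p * q = 6 := by
    rw [hp, hq, ← mul_rpow (by positivity) (by positivity)]
    have : 36 * r * (6 / r) = (6 : ℝ) ^ (3 : ℝ) := by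
      field_simp
      norm_num
    rw [this, ← rpow_mul (by norm_num)]
    norm_num
  have hy : amplitude r d = 2 / 3 * p / G + 1 / 3 * q * G := rfl
  have huv : (2 / 3 * p / G) * (1 / 3 * q * G) = 4 / 3 := by
    field_simp
    linarith
  have hu3 : r * (2 / 3 * p / G) ^ 3 = 2 * d - 2 / 9 * S := by
    have : r * (2 / 3 * p / G) ^ 3 = 8 / 27 * r * p ^ 3 / G ^ 3 := by ring
    rw [this, hp3, hG3, div_eq_iff (by positivity)]
    linear_combination (2 / 9) * hS2
  have hv3 : r * (1 / 3 * q * G) ^ 3 = 2 * d + 2 / 9 * S := by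
    have : r * (1 / 3 * q * G) ^ 3 = 1 / 27 * r * q ^ 3 * G ^ 3 := by ring
    rw [this, hq3, hG3]
    field_simp
    ring
  rw [hy]
  linear_combination (-1 / 4) * hu3 - (1 / 4) * hv3
    - (3 / 4) * r * (2 / 3 * p / G + 1 / 3 * q * G) * huv

end DuffingVanDerPol

end


/-- Theorem 1 of the paper, existence part.
For `(ρ, δ, α, λ) = (εr, εd, ε^{n₂}a, ε^{n₃}ℓ)` with `n₂, n₃ > 1` and `81d² > 48r² > 0`,
the extended Duffing–Van der Pol system has a `2π`-periodic solution whose initial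
condition tends to `(0, y₀⁰)` as `ε → 0⁺`. -/
theorem stmt_0 (r d a l : ℝ) (n₂ n₃ : ℤ)
    (hr : 0 < r) (hd : 0 < d) (hrd : 81 * d ^ 2 > 48 * r ^ 2)
    (hn₂ : 1 < n₂) (hn₃ : 1 < n₃) (hl : l ≠ 0) :
    ∃ ε₀ > (0 : ℝ), ∃ X Y : ℝ → ℝ → ℝ,
      (∀ ε ∈ Set.Ioo (0 : ℝ) ε₀,
        (∀ t, HasDerivAt (X ε) (Y ε t) t) ∧
        (∀ t, HasDerivAt (Y ε)
          (-(X ε t) + ε * r * Y ε t - ε * r * (X ε t) ^ 2 * Y ε t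
            - ε ^ n₂ * a * (X ε t) ^ 3 - ε ^ n₃ * l * (X ε t) ^ 5
            + ε * d * Real.cos t) t) ∧
        (∀ t, X ε (t + 2 * Real.pi) = X ε t) ∧
        (∀ t, Y ε (t + 2 * Real.pi) = Y ε t)) ∧
      Filter.Tendsto (fun ε => (X ε 0, Y ε 0)) (nhdsWithin 0 (Set.Ioi 0))
        (nhds ((0 : ℝ),
          2 / 3 * (36 * r) ^ ((1 : ℝ) / 3)
              / ((9 * d + Real.sqrt (81 * d ^ 2 - 48 * r ^ 2)) ^ ((1 : ℝ) / 3))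
            + 1 / 3 * (6 / r) ^ ((1 : ℝ) / 3)
              * ((9 * d + Real.sqrt (81 * d ^ 2 - 48 * r ^ 2)) ^ ((1 : ℝ) / 3)))) := by
  obtain ⟨m, rfl⟩ : ∃ m : ℕ, n₂ = ((m + 2 : ℕ) : ℤ) := ⟨(n₂ - 2).toNat, by omega⟩
  obtain ⟨k, rfl⟩ : ∃ k : ℕ, n₃ = ((k + 2 : ℕ) : ℤ) := ⟨(n₃ - 2).toNat, by omega⟩
  set y := DuffingVanDerPol.amplitude r d
  have hroot : r * y - r * y ^ 3 / 4 + d = 0 := DuffingVanDerPol.amplitude_root hr hd hrd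
  have hy : 0 < y := DuffingVanDerPol.amplitude_pos hr hd
  have hy2 : 4 < y ^ 2 := by
    by_contra! hle
    nlinarith [mul_nonneg (mul_pos hr hy).le (sub_nonneg.mpr hle)]
  have hcd := (DuffingVanDerPol.contDiff_periodicOperator r d a l m k).contDiffAt
    (x := (0, DuffingVanDerPol.basePoint y))
  have hinv := DuffingVanDerPol.isInvertible_fderiv_periodicOperator (d := d) (a := a) (l := l)
    (m := m) (k := k) (y := y) hr.ne' (by linarith) (by linarith)
  set u := hcd.implicitFunction one_ne_zero hinv
  have hu : ∀ᶠ ε in nhds (0 : ℝ), DuffingVanDerPol.periodicOperator r d a l m k (ε, u ε) = 0 := by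
    filter_upwards [hcd.eventually_apply_implicitFunction one_ne_zero hinv] with ε hε
    exact hε.trans (DuffingVanDerPol.periodicOperator_basePoint hroot)
  have hu0 : u 0 = DuffingVanDerPol.basePoint y := hcd.implicitFunction_apply_self one_ne_zero hinv
  have hcont : ContinuousAt u 0 :=
    (hcd.hasStrictFDerivAt_implicitFunction one_ne_zero hinv).continuousAt
  obtain ⟨ε₀, hε₀, hball⟩ := Metric.eventually_nhds_iff.mp hu
  refine ⟨ε₀, hε₀, fun ε t => DuffingVanDerPol.position (u ε) (t : AddCircle (2 * Real.pi)),
    fun ε t => DuffingVanDerPol.velocity (u ε) (t : AddCircle (2 * Real.pi)),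
    fun ε hε => ?_, ?_⟩
  · have hz := hball (y := ε) (by simpa [abs_of_pos hε.1] using hε.2)
    refine ⟨DuffingVanDerPol.hasDerivAt_position hz, fun t => ?_, fun t => ?_, fun t => ?_⟩
    · refine (DuffingVanDerPol.hasDerivAt_velocity hz t).congr_deriv ?_
      simp only [zpow_natCast, DuffingVanDerPol.force, ContinuousMap.add_apply,
        ContinuousMap.sub_apply, ContinuousMap.smul_apply, ContinuousMap.mul_apply,
        ContinuousMap.pow_apply, smul_eq_mul, DuffingVanDerPol.cosP_coe]
      ring
    · simp only [AddCircle.coe_add_period]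
    · simp only [AddCircle.coe_add_period]
  · have h1 : ContinuousAt (fun ε => (DuffingVanDerPol.evalZero (DuffingVanDerPol.position (u ε)),
        DuffingVanDerPol.evalZero (DuffingVanDerPol.velocity (u ε)))) 0 := by
      fun_prop
    have h2 := h1.tendsto.mono_left (nhdsWithin_le_nhds (s := Set.Ioi 0))
    have h3 : (DuffingVanDerPol.evalZero (DuffingVanDerPol.position (u 0)),
        DuffingVanDerPol.evalZero (DuffingVanDerPol.velocity (u 0))) = (0, y) := by
      rw [hu0, DuffingVanDerPol.position_basePoint, DuffingVanDerPol.velocity_basePoint]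
      simp
    rw [h3] at h2
    exact h2
end

section
/- Let a ≠ 0 and d > 0 be real numbers, let n₁, n₃ be integers greater than 1, and let r ≥ 0 and ℓ ≠ 0 be real. Then there exists ε₀ > 0 such that for every ε ∈ (0, ε₀) the system ẋ = y, ẏ = −x + ε^{n₁} r y − ε^{n₁} r x² y − ε a x³ − ε^{n₃} ℓ x⁵ + ε d cos t has a 2π-periodic solution (x(t,ε), y(t,ε)), and these solutions can be chosen so that (x(0,ε), y(0,ε)) → ((4d/(3a))^{1/3}, 0) as ε → 0⁺. -/
open Real MeasureTheory intervalIntegral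

noncomputable section

namespace ForcedOscillator

local instance : Fact (0 < 2 * π) := ⟨Real.two_pi_pos⟩

/-- Continuous real functions on the circle of length `2π`. -/
abbrev PeriodicFun : Type := C(AddCircle (2 * π), ℝ)

theorem continuous_coe_comp (g : PeriodicFun) : Continuous fun t : ℝ => g (t : AddCircle (2 * π)) :=
  g.continuous.comp (AddCircle.continuous_mk' _)

theorem periodic_coe_comp (g : PeriodicFun) :
    Function.Periodic (fun t : ℝ => g (t : AddCircle (2 * π))) (2 * π) := fun t => by
  simp only [AddCircle.coe_add_period]

theorem intervalIntegrable_coe_comp (g : PeriodicFun) (s t : ℝ) :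
    IntervalIntegrable (fun t : ℝ => g (t : AddCircle (2 * π))) volume s t :=
  (continuous_coe_comp g).intervalIntegrable s t

theorem norm_integral_le (g : PeriodicFun) (t : ℝ) :
    ‖∫ s in (0 : ℝ)..t, g (s : AddCircle (2 * π))‖ ≤ ‖g‖ * |t| := by
  simpa using norm_integral_le_of_norm_le_const (a := 0) (b := t) (C := ‖g‖)
    (f := fun s : ℝ => g (s : AddCircle (2 * π))) (fun s _ => g.norm_coe_le_norm _)

/-- The integral over one period. -/
def periodIntegral : PeriodicFun →L[ℝ] ℝ :=
  LinearMap.mkContinuous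
    { toFun := fun g => ∫ s in (0 : ℝ)..2 * π, g (s : AddCircle (2 * π))
      map_add' := fun g h => by
        simpa using integral_add (intervalIntegrable_coe_comp g _ _)
          (intervalIntegrable_coe_comp h _ _)
      map_smul' := fun c g => by simp }
    (2 * π) (fun g => by
      have := norm_integral_le g (2 * π)
      rw [abs_of_pos Real.two_pi_pos] at this
      simpa [mul_comm] using this)

theorem periodIntegral_apply (g : PeriodicFun) :
    periodIntegral g = ∫ s in (0 : ℝ)..2 * π, g (s : AddCircle (2 * π)) := rfl

/-- The primitive vanishing at `0` of `g` minus its mean, as a function on the line. -/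
def primitiveAux (g : PeriodicFun) (t : ℝ) : ℝ :=
  (∫ s in (0 : ℝ)..t, g (s : AddCircle (2 * π))) - t / (2 * π) * periodIntegral g

theorem periodic_primitiveAux (g : PeriodicFun) : Function.Periodic (primitiveAux g) (2 * π) := by
  intro t
  have h := (periodic_coe_comp g).intervalIntegral_add_eq t 0
  rw [zero_add, ← periodIntegral_apply] at h
  have h2 := integral_add_adjacent_intervals (intervalIntegrable_coe_comp g 0 t)
    (intervalIntegrable_coe_comp g t (t + 2 * π))
  have hpi := Real.pi_ne_zero
  rw [primitiveAux, primitiveAux, ← h2, h]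
  field_simp
  ring

theorem continuous_primitiveAux (g : PeriodicFun) : Continuous (primitiveAux g) := by
  have h : Continuous fun t : ℝ => ∫ s in (0 : ℝ)..t, g (s : AddCircle (2 * π)) :=
    continuous_primitive (fun s t => intervalIntegrable_coe_comp g s t) 0
  unfold primitiveAux
  fun_prop

/-- The primitive vanishing at `0` of `g` minus its mean, as a bounded operator. -/
def primitive : PeriodicFun →L[ℝ] PeriodicFun :=
  LinearMap.mkContinuous
    { toFun := fun g => ⟨(periodic_primitiveAux g).lift,
        continuous_quot_lift _ (continuous_primitiveAux g)⟩
      map_add' := fun g h => by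
        ext x
        obtain ⟨t, rfl⟩ := QuotientAddGroup.mk_surjective x
        have : (∫ s in (0 : ℝ)..t, (g (s : AddCircle (2 * π)) + h (s : AddCircle (2 * π)))) = _ :=
          integral_add (intervalIntegrable_coe_comp g _ _) (intervalIntegrable_coe_comp h _ _)
        change primitiveAux (g + h) t = primitiveAux g t + primitiveAux h t
        simp only [primitiveAux, map_add, ContinuousMap.add_apply, this]
        ring
      map_smul' := fun c g => by
        ext x
        obtain ⟨t, rfl⟩ := QuotientAddGroup.mk_surjective x
        change primitiveAux (c • g) t = c * primitiveAux g t
        simp only [primitiveAux, map_smul, ContinuousMap.smul_apply, smul_eq_mul,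
          intervalIntegral.integral_const_mul]
        ring }
    (4 * π) (fun g => by
      refine (ContinuousMap.norm_le _ (by positivity)).2 fun x => ?_
      obtain ⟨t, ht, rfl⟩ := AddCircle.eq_coe_Ico x
      change ‖(∫ s in (0 : ℝ)..t, g (s : AddCircle (2 * π))) - t / (2 * π) * periodIntegral g‖ ≤ _
      have h1 := norm_integral_le g t
      have h2 := norm_integral_le g (2 * π)
      rw [← periodIntegral_apply, abs_of_pos Real.two_pi_pos] at h2
      rw [abs_of_nonneg ht.1] at h1
      have h3 : ‖t / (2 * π) * periodIntegral g‖ ≤ 1 * ‖periodIntegral g‖ := by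
        rw [norm_mul]
        gcongr
        rw [Real.norm_of_nonneg (div_nonneg ht.1 Real.two_pi_pos.le)]
        exact (div_le_one Real.two_pi_pos).2 ht.2.le
      have h4 : ‖g‖ * t ≤ ‖g‖ * (2 * π) := by gcongr; exact ht.2.le
      have h5 := norm_sub_le (∫ s in (0 : ℝ)..t, g (s : AddCircle (2 * π)))
        (t / (2 * π) * periodIntegral g)
      linarith)

theorem primitive_coe (g : PeriodicFun) (t : ℝ) :
    primitive g (t : AddCircle (2 * π)) =
      (∫ s in (0 : ℝ)..t, g (s : AddCircle (2 * π))) - t / (2 * π) * periodIntegral g := rfl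

theorem primitive_zero (g : PeriodicFun) : primitive g 0 = 0 := by
  have := primitive_coe g 0
  simpa using this

/-- The inclusion of the constants. -/
def constFun : ℝ →L[ℝ] PeriodicFun := Algebra.linearMap ℝ PeriodicFun |>.toContinuousLinearMap

@[simp] theorem constFun_apply (c : ℝ) (x : AddCircle (2 * π)) : constFun c x = c := rfl

/-- Evaluation at the base point of the circle. -/
def evalZero : PeriodicFun →L[ℝ] ℝ := ContinuousMap.evalCLM ℝ (0 : AddCircle (2 * π))

@[simp] theorem evalZero_apply (g : PeriodicFun) : evalZero g = g 0 := rfl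

/-- Cosine on the circle. -/
def cosFun : PeriodicFun := ⟨Real.Angle.cos, Real.Angle.continuous_cos⟩

/-- Sine on the circle. -/
def sinFun : PeriodicFun := ⟨Real.Angle.sin, Real.Angle.continuous_sin⟩

@[simp] theorem cosFun_coe (t : ℝ) : cosFun (t : AddCircle (2 * π)) = cos t := rfl

@[simp] theorem sinFun_coe (t : ℝ) : sinFun (t : AddCircle (2 * π)) = sin t := rfl

/-- The perturbing force `F` in `x'' + x = ε F`, in the rotating coordinates
`x = u cos + v sin`, `y = -u sin + v cos`. -/
def force (a d r l : ℝ) (k m : ℕ) (ε : ℝ) (u v : PeriodicFun) : PeriodicFun :=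
  d • cosFun - a • (u * cosFun + v * sinFun) ^ 3
    + (ε ^ k * r) • ((1 - (u * cosFun + v * sinFun) ^ 2) * (v * cosFun - u * sinFun))
    - (ε ^ m * l) • (u * cosFun + v * sinFun) ^ 5

/-- The map whose zeros `(ε, u, v)` give the `2π`-periodic solutions of
`u' = -ε F sin`, `v' = ε F cos`. -/
def residual (a d r l : ℝ) (k m : ℕ) (p : ℝ × PeriodicFun × PeriodicFun) :
    PeriodicFun × PeriodicFun :=
  (p.2.1 - constFun (evalZero p.2.1)
      + p.1 • primitive (force a d r l k m p.1 p.2.1 p.2.2 * sinFun)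
      + constFun (periodIntegral (force a d r l k m p.1 p.2.1 p.2.2 * sinFun)),
    p.2.2 - constFun (evalZero p.2.2)
      - p.1 • primitive (force a d r l k m p.1 p.2.1 p.2.2 * cosFun)
      + constFun (periodIntegral (force a d r l k m p.1 p.2.1 p.2.2 * cosFun)))

theorem contDiff_residual (a d r l : ℝ) (k m : ℕ) : ContDiff ℝ 1 (residual a d r l k m) := by
  unfold residual force
  fun_prop

theorem integral_cos_pow_four : ∫ t in (0 : ℝ)..2 * π, cos t ^ 4 = 3 * π / 4 := by
  have := integral_cos_pow (a := 0) (b := 2 * π) 2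
  norm_num at this
  rw [this]; ring

theorem integral_cos_pow_three_mul_sin : ∫ t in (0 : ℝ)..2 * π, cos t ^ 3 * sin t = 0 := by
  have h : ∀ t ∈ Set.uIcc (0 : ℝ) (2 * π), HasDerivAt (fun t => -(cos t ^ 4) / 4)
      (cos t ^ 3 * sin t) t := fun t _ => by
    refine ((hasDerivAt_cos t).fun_pow 4).fun_neg.div_const 4 |>.congr_deriv ?_
    push_cast
    ring
  rw [integral_eq_sub_of_hasDerivAt h ((by fun_prop : Continuous _).intervalIntegrable _ _)]
  simp

theorem integral_sin_sq_mul_cos_sq_period :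
    ∫ t in (0 : ℝ)..2 * π, sin t ^ 2 * cos t ^ 2 = π / 4 := by
  have h : sin (4 * (2 * π)) = 0 := by
    have := Real.sin_nat_mul_pi 8
    rw [← this]; congr 1; push_cast; ring
  rw [integral_sin_sq_mul_cos_sq, h]; simp; ring

theorem periodIntegral_cos_sq : periodIntegral (cosFun ^ 2) = π := by
  simp [periodIntegral_apply, integral_cos_sq]

theorem periodIntegral_cos_mul_sin : periodIntegral (cosFun * sinFun) = 0 := by
  simp only [periodIntegral_apply, ContinuousMap.mul_apply, cosFun_coe, sinFun_coe,
    mul_comm (cos _), integral_sin_mul_cos₁]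
  simp

theorem periodIntegral_cos_pow_four : periodIntegral (cosFun ^ 4) = 3 * π / 4 := by
  simpa [periodIntegral_apply] using integral_cos_pow_four

theorem periodIntegral_cos_pow_three_mul_sin : periodIntegral (cosFun ^ 3 * sinFun) = 0 := by
  simpa [periodIntegral_apply] using integral_cos_pow_three_mul_sin

theorem periodIntegral_sin_sq_mul_cos_sq :
    periodIntegral (sinFun ^ 2 * cosFun ^ 2) = π / 4 := by
  simpa [periodIntegral_apply] using integral_sin_sq_mul_cos_sq_period

theorem force_zero (a d r l : ℝ) {k m : ℕ} (hk : k ≠ 0) (hm : m ≠ 0) (u v : PeriodicFun) :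
    force a d r l k m 0 u v = d • cosFun - a • (u * cosFun + v * sinFun) ^ 3 := by
  simp [force, hk, hm]

theorem residual_zero_const (a d r l c : ℝ) {k m : ℕ} (hk : k ≠ 0) (hm : m ≠ 0)
    (hc : 3 * a * c ^ 3 = 4 * d) : residual a d r l k m (0, constFun c, 0) = 0 := by
  have h1 : constFun c * cosFun = c • cosFun := rfl
  have hs : (d • cosFun - a • (c • cosFun) ^ 3) * sinFun
      = d • (cosFun * sinFun) - (a * c ^ 3) • (cosFun ^ 3 * sinFun) := by
    ext x; simp; ring
  have hcos : (d • cosFun - a • (c • cosFun) ^ 3) * cosFun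
      = d • cosFun ^ 2 - (a * c ^ 3) • cosFun ^ 4 := by
    ext x; simp; ring
  have h3 : d * π - a * c ^ 3 * (3 * π / 4) = 0 := by linear_combination -π / 4 * hc
  simp [residual, force_zero a d r l hk hm, h1, hs, hcos, periodIntegral_cos_mul_sin,
    periodIntegral_cos_pow_three_mul_sin, periodIntegral_cos_sq, periodIntegral_cos_pow_four, h3]

/-- The linearization of the unperturbed force along `c cos`, up to the factor `-3 a c ^ 2`. -/
def linForce : PeriodicFun × PeriodicFun → PeriodicFun :=
  fun w => cosFun ^ 2 * (w.1 * cosFun + w.2 * sinFun)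

/-- The partial derivative of `residual` at `(0, c, 0)`. -/
theorem fderiv_residual_inr (a d r l c : ℝ) {k m : ℕ} (hk : k ≠ 0) (hm : m ≠ 0)
    (w : PeriodicFun × PeriodicFun) :
    fderiv ℝ (residual a d r l k m) (0, constFun c, 0) (0, w) =
      (w.1 - constFun (w.1 0) + constFun (-3 * a * c ^ 2 * periodIntegral (linForce w * sinFun)),
       w.2 - constFun (w.2 0)
        + constFun (-3 * a * c ^ 2 * periodIntegral (linForce w * cosFun))) := by
  have hD := ((contDiff_residual a d r l k m).differentiable one_ne_zero
    (0, constFun c, 0)).hasFDerivAt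
  have hline : HasDerivAt (fun s : ℝ => ((0 : ℝ), constFun c + s • w.1, s • w.2)) (0, w) 0 := by
    have h1 := ((hasDerivAt_id (0 : ℝ)).smul_const w.1).const_add (constFun c)
    have h2 := (hasDerivAt_id (0 : ℝ)).smul_const w.2
    simpa using (hasDerivAt_const (0 : ℝ) (0 : ℝ)).prodMk (h1.prodMk h2)
  have hcomp := HasFDerivAt.comp_hasDerivAt_of_eq (0 : ℝ) hD hline (by simp)
  refine hcomp.unique ?_
  have hu : HasDerivAt (fun s : ℝ => constFun c + s • w.1) w.1 0 := by
    simpa using ((hasDerivAt_id (0 : ℝ)).smul_const w.1).const_add (constFun c)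
  have hv : HasDerivAt (fun s : ℝ => s • w.2) w.2 0 := by
    simpa using (hasDerivAt_id (0 : ℝ)).smul_const w.2
  have hF : HasDerivAt (fun s : ℝ => force a d r l k m 0 (constFun c + s • w.1) (s • w.2))
      ((-3 * a * c ^ 2) • linForce w) 0 := by
    simp only [force_zero a d r l hk hm]
    refine ((((hu.mul_const cosFun).fun_add (hv.mul_const sinFun)).fun_pow 3).const_smul a).const_sub
      (d • cosFun) |>.congr_deriv ?_
    ext x
    have h3 : (3 : PeriodicFun) x = 3 := rfl
    simp [linForce, h3]
    ring
  have hK := fun {f : ℝ → PeriodicFun} {f' : PeriodicFun} (hf : HasDerivAt f f' 0) =>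
    (constFun ∘L evalZero).hasFDerivAt.comp_hasDerivAt (0 : ℝ) hf
  have hI := fun {f : ℝ → PeriodicFun} {f' : PeriodicFun} (hf : HasDerivAt f f' 0) =>
    (constFun ∘L periodIntegral).hasFDerivAt.comp_hasDerivAt (0 : ℝ) hf
  have e1 := (hu.sub (hK hu)).add (hI (hF.mul_const sinFun))
  have e2 := (hv.sub (hK hv)).add (hI (hF.mul_const cosFun))
  refine ((e1.prodMk e2).congr_deriv ?_).congr_of_eventuallyEq ?_
  · simp
  · filter_upwards with s
    simp [residual, ← smul_eq_mul]

theorem periodIntegral_linForce_const (p q : ℝ) :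
    periodIntegral (linForce (constFun p, constFun q) * sinFun) = π / 4 * q ∧
    periodIntegral (linForce (constFun p, constFun q) * cosFun) = 3 * π / 4 * p := by
  have h1 : linForce (constFun p, constFun q) * sinFun
      = p • (cosFun ^ 3 * sinFun) + q • (sinFun ^ 2 * cosFun ^ 2) := by
    ext x; simp [linForce]; ring
  have h2 : linForce (constFun p, constFun q) * cosFun
      = p • cosFun ^ 4 + q • (cosFun ^ 3 * sinFun) := by
    ext x; simp [linForce]; ring
  rw [h1, h2]
  simp only [map_add, map_smul, smul_eq_mul, periodIntegral_cos_pow_three_mul_sin,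
    periodIntegral_cos_pow_four, periodIntegral_sin_sq_mul_cos_sq]
  constructor <;> ring

theorem linForce_add (w w' : PeriodicFun × PeriodicFun) :
    linForce (w + w') = linForce w + linForce w' := by
  simp only [linForce, Prod.fst_add, Prod.snd_add]
  ring

theorem isInvertible_fderiv_residual_inr {a c : ℝ} (d r l : ℝ) {k m : ℕ} (hk : k ≠ 0)
    (hm : m ≠ 0) (ha : a ≠ 0) (hc : c ≠ 0) :
    (fderiv ℝ (residual a d r l k m) (0, constFun c, 0) ∘L
      .inr ℝ ℝ (PeriodicFun × PeriodicFun)).IsInvertible := by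
  set D := fderiv ℝ (residual a d r l k m) (0, constFun c, 0) ∘L
      .inr ℝ ℝ (PeriodicFun × PeriodicFun)
  have hD : ∀ w, D w = _ := fun w => fderiv_residual_inr a d r l c hk hm w
  have hpi := Real.pi_ne_zero
  have hinj : D.ker = ⊥ := by
    refine (LinearMap.ker_eq_bot' (f := D.toLinearMap)).2 fun w hw => ?_
    have hw' : D w = 0 := hw
    rw [hD, Prod.mk_eq_zero] at hw'
    obtain ⟨h1, h2⟩ := hw'
    have k1 : -3 * a * c ^ 2 * periodIntegral (linForce w * sinFun) = 0 := by
      simpa using DFunLike.congr_fun h1 0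
    have k2 : -3 * a * c ^ 2 * periodIntegral (linForce w * cosFun) = 0 := by
      simpa using DFunLike.congr_fun h2 0
    rw [k1, constFun.map_zero, add_zero, sub_eq_zero] at h1
    rw [k2, constFun.map_zero, add_zero, sub_eq_zero] at h2
    have hwc : w = (constFun (w.1 0), constFun (w.2 0)) := Prod.ext h1 h2
    obtain ⟨i1, i2⟩ := periodIntegral_linForce_const (w.1 0) (w.2 0)
    rw [← hwc] at i1 i2
    rw [i1] at k1
    rw [i2] at k2
    have q0 : w.2 0 = 0 := by simpa [ha, hc, hpi] using k1
    have p0 : w.1 0 = 0 := by simpa [ha, hc, hpi] using k2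
    rw [hwc, p0, q0, constFun.map_zero]
    rfl
  have hsurj : D.range = ⊤ := by
    refine (LinearMap.range_eq_top (f := D.toLinearMap)).2 fun w => ?_
    set w' : PeriodicFun × PeriodicFun := (w.1 - constFun (w.1 0), w.2 - constFun (w.2 0)) with hw'
    obtain ⟨q, hq⟩ : ∃ q, -3 * a * c ^ 2 * (periodIntegral (linForce w' * sinFun) + π / 4 * q)
        = w.1 0 :=
      ⟨(w.1 0 / (-3 * a * c ^ 2) - periodIntegral (linForce w' * sinFun)) / (π / 4), by
        field_simp; ring⟩
    obtain ⟨p, hp⟩ : ∃ p, -3 * a * c ^ 2 * (periodIntegral (linForce w' * cosFun) + 3 * π / 4 * p)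
        = w.2 0 :=
      ⟨(w.2 0 / (-3 * a * c ^ 2) - periodIntegral (linForce w' * cosFun)) / (3 * π / 4), by
        field_simp; ring⟩
    obtain ⟨i1, i2⟩ := periodIntegral_linForce_const p q
    refine ⟨w' + (constFun p, constFun q), (hD _).trans ?_⟩
    rw [linForce_add, add_mul, add_mul, map_add, map_add, i1, i2, hq, hp]
    refine Prod.ext ?_ ?_ <;> ext x <;> simp [hw']
  exact ⟨ContinuousLinearEquiv.ofBijective D hinj hsurj,
    ContinuousLinearEquiv.coe_ofBijective D hinj hsurj⟩

/-- Zeros of `residual` solve the equations in rotating coordinates. -/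
theorem hasDerivAt_of_residual_eq_zero {a d r l : ℝ} {k m : ℕ} {ε : ℝ} {u v : PeriodicFun}
    (h : residual a d r l k m (ε, u, v) = 0) (t : ℝ) :
    HasDerivAt (fun t : ℝ => u (t : AddCircle (2 * π)))
      (-ε * (force a d r l k m ε u v (t : AddCircle (2 * π)) * sin t)) t ∧
    HasDerivAt (fun t : ℝ => v (t : AddCircle (2 * π)))
      (ε * (force a d r l k m ε u v (t : AddCircle (2 * π)) * cos t)) t := by
  obtain ⟨h1, h2⟩ := Prod.mk_eq_zero.1 h
  simp only at h1 h2
  set F := force a d r l k m ε u v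
  have k1 : periodIntegral (F * sinFun) = 0 := by
    simpa [primitive_zero] using DFunLike.congr_fun h1 0
  have k2 : periodIntegral (F * cosFun) = 0 := by
    simpa [primitive_zero] using DFunLike.congr_fun h2 0
  have hp : ∀ g : PeriodicFun, HasDerivAt
      (fun t : ℝ => ∫ s in (0 : ℝ)..t, g (s : AddCircle (2 * π))) (g (t : AddCircle (2 * π))) t :=
    fun g => integral_hasDerivAt_right (intervalIntegrable_coe_comp g _ _)
      (continuous_coe_comp g).stronglyMeasurable.stronglyMeasurableAtFilter
      (continuous_coe_comp g).continuousAt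
  constructor
  · refine (((hp (F * sinFun)).const_mul (-ε)).const_add (u 0)).congr_of_eventuallyEq ?_
    filter_upwards with s
    have := DFunLike.congr_fun h1 (s : AddCircle (2 * π))
    simp only [k1, ContinuousMap.add_apply, ContinuousMap.sub_apply, constFun_apply,
      ContinuousMap.smul_apply, primitive_coe, ContinuousMap.zero_apply, smul_eq_mul,
      evalZero_apply, mul_zero, sub_zero] at this
    linarith
  · refine (((hp (F * cosFun)).const_mul ε).const_add (v 0)).congr_of_eventuallyEq ?_
    filter_upwards with s
    have := DFunLike.congr_fun h2 (s : AddCircle (2 * π))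
    simp only [k2, ContinuousMap.add_apply, ContinuousMap.sub_apply, constFun_apply,
      ContinuousMap.smul_apply, primitive_coe, ContinuousMap.zero_apply, smul_eq_mul,
      evalZero_apply, mul_zero, sub_zero] at this
    linarith

/-- The branch of zeros of `residual` through `(0, c, 0)`. -/
theorem exists_tendsto_residual_eq_zero {a c d : ℝ} (r l : ℝ) {k m : ℕ} (hk : k ≠ 0) (hm : m ≠ 0)
    (ha : a ≠ 0) (hc : c ≠ 0) (h : 3 * a * c ^ 3 = 4 * d) :
    ∃ ψ : ℝ → PeriodicFun × PeriodicFun,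
      Filter.Tendsto ψ (nhds 0) (nhds (constFun c, 0)) ∧
      ∀ᶠ ε in nhds (0 : ℝ), residual a d r l k m (ε, ψ ε) = 0 := by
  have hstrict := (contDiff_residual a d r l k m).contDiffAt.hasStrictFDerivAt
    (x := (0, constFun c, 0)) one_ne_zero
  have hinv := isInvertible_fderiv_residual_inr d r l hk hm ha hc
  have hev := hstrict.eventually_apply_implicitFunctionOfProdDomain hinv
  rw [residual_zero_const a d r l c hk hm h] at hev
  exact ⟨_, hstrict.tendsto_implicitFunctionOfProdDomain hinv, hev⟩

theorem exists_cube_eq (x : ℝ) : ∃ c : ℝ, c ^ 3 = x := by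
  rcases le_total 0 x with h | h
  · exact ⟨x ^ ((3 : ℕ) : ℝ)⁻¹, Real.rpow_inv_natCast_pow h (by norm_num)⟩
  · refine ⟨-(-x) ^ ((3 : ℕ) : ℝ)⁻¹, ?_⟩
    rw [Odd.neg_pow (by decide), Real.rpow_inv_natCast_pow (neg_nonneg.2 h) (by norm_num), neg_neg]

end ForcedOscillator

end

open ForcedOscillator in
/-- Theorem 2 of the paper.
For `(α, δ, ρ, λ) = (εa, εd, ε^{n₁}r, ε^{n₃}ℓ)` with `n₁, n₃ > 1` and `a ≠ 0`,
the system has a `2π`-periodic solution whose initial condition tends to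
`((4d/(3a))^{1/3}, 0)` as `ε → 0⁺`.  The real cube root is characterised by
its cube: `c ^ 3 = 4d/(3a)`. -/
theorem stmt_1 (a d r l : ℝ) (n₁ n₃ : ℤ)
    (ha : a ≠ 0) (hd : 0 < d) (hn₁ : 1 < n₁) (hn₃ : 1 < n₃)
    (hr : 0 ≤ r) (hl : l ≠ 0) :
    ∃ c : ℝ, c ^ 3 = 4 * d / (3 * a) ∧
      ∃ ε₀ > (0 : ℝ), ∃ X Y : ℝ → ℝ → ℝ,
        (∀ ε ∈ Set.Ioo (0 : ℝ) ε₀,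
          (∀ t, HasDerivAt (X ε) (Y ε t) t) ∧
          (∀ t, HasDerivAt (Y ε)
            (-(X ε t) + ε ^ n₁ * r * Y ε t - ε ^ n₁ * r * (X ε t) ^ 2 * Y ε t
              - ε * a * (X ε t) ^ 3 - ε ^ n₃ * l * (X ε t) ^ 5
              + ε * d * Real.cos t) t) ∧
          (∀ t, X ε (t + 2 * Real.pi) = X ε t) ∧
          (∀ t, Y ε (t + 2 * Real.pi) = Y ε t)) ∧
        Filter.Tendsto (fun ε => (X ε 0, Y ε 0)) (nhdsWithin 0 (Set.Ioi 0))
          (nhds (c, (0 : ℝ))) := by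
  obtain ⟨c, hc⟩ := exists_cube_eq (4 * d / (3 * a))
  refine ⟨c, hc, ?_⟩
  obtain ⟨k, rfl, hk⟩ : ∃ k : ℕ, n₁ = ((k + 1 : ℕ) : ℤ) ∧ k ≠ 0 :=
    ⟨(n₁ - 1).toNat, by omega, by omega⟩
  obtain ⟨m, rfl, hm⟩ : ∃ m : ℕ, n₃ = ((m + 1 : ℕ) : ℤ) ∧ m ≠ 0 :=
    ⟨(n₃ - 1).toNat, by omega, by omega⟩
  have hc0 : c ≠ 0 := by
    rintro rfl
    have : 4 * d / (3 * a) ≠ 0 := by positivity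
    exact this (by rw [← hc]; norm_num)
  have hc' : 3 * a * c ^ 3 = 4 * d := by rw [hc]; field_simp
  obtain ⟨ψ, htend, hev⟩ := exists_tendsto_residual_eq_zero r l hk hm ha hc0 hc'
  obtain ⟨ε₀, hε₀, hball⟩ := Metric.eventually_nhds_iff.1 hev
  refine ⟨ε₀, hε₀, fun ε t => (ψ ε).1 (t : AddCircle (2 * π)) * Real.cos t
      + (ψ ε).2 (t : AddCircle (2 * π)) * Real.sin t,
    fun ε t => (ψ ε).2 (t : AddCircle (2 * π)) * Real.cos t
      - (ψ ε).1 (t : AddCircle (2 * π)) * Real.sin t, fun ε hε => ?_, ?_⟩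
  · have hsol := hasDerivAt_of_residual_eq_zero
      (hball (y := ε) (by rw [Real.dist_eq, sub_zero, abs_of_pos hε.1]; exact hε.2))
    refine ⟨fun t => ?_, fun t => ?_, fun t => ?_, fun t => ?_⟩
    · obtain ⟨hu, hv⟩ := hsol t
      refine ((hu.mul (Real.hasDerivAt_cos t)).add (hv.mul (Real.hasDerivAt_sin t))).congr_deriv ?_
      ring
    · obtain ⟨hu, hv⟩ := hsol t
      refine ((hv.mul (Real.hasDerivAt_cos t)).sub (hu.mul (Real.hasDerivAt_sin t))).congr_deriv ?_
      simp only [force, zpow_natCast, pow_succ ε, ContinuousMap.add_apply, ContinuousMap.sub_apply,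
        ContinuousMap.smul_apply, ContinuousMap.mul_apply, ContinuousMap.pow_apply,
        ContinuousMap.one_apply, smul_eq_mul, cosFun_coe, sinFun_coe]
      set u := (ψ ε).1 (t : AddCircle (2 * π))
      set v := (ψ ε).2 (t : AddCircle (2 * π))
      set F := d * Real.cos t - a * (u * Real.cos t + v * Real.sin t) ^ 3
        + ε ^ k * r * ((1 - (u * Real.cos t + v * Real.sin t) ^ 2)
          * (v * Real.cos t - u * Real.sin t))
        - ε ^ m * l * (u * Real.cos t + v * Real.sin t) ^ 5 with hF
      rw [← sub_eq_zero]
      linear_combination ε * F * Real.sin_sq_add_cos_sq t + ε * hF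
    · simp only [AddCircle.coe_add_period, Real.cos_add_two_pi, Real.sin_add_two_pi]
    · simp only [AddCircle.coe_add_period, Real.cos_add_two_pi, Real.sin_add_two_pi]
  · have h1 := (evalZero.continuous.tendsto _).comp
      ((continuous_fst.tendsto _).comp htend)
    have h2 := (evalZero.continuous.tendsto _).comp
      ((continuous_snd.tendsto _).comp htend)
    simpa [Function.comp_def] using (h1.prodMk_nhds h2).mono_left nhdsWithin_le_nhds
end

section
/- Let ℓ ≠ 0 and d > 0 be real numbers, let n₁, n₂ be integers greater than 1, and let r ≥ 0 and a be real. Then there exists ε₀ > 0 such that for every ε ∈ (0, ε₀) the system ẋ = y, ẏ = −x + ε^{n₁} r y − ε^{n₁} r x² y − ε^{n₂} a x³ − ε ℓ x⁵ + ε d cos t has a 2π-periodic solution (x(t,ε), y(t,ε)), and these solutions can be chosen so that (x(0,ε), y(0,ε)) → ((8d/(5ℓ))^{1/5}, 0) as ε → 0⁺. -/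
open Filter Topology Set

section Averaging

variable {V : Type*} [NormedAddCommGroup V] {T : ℝ}

theorem ContinuousMap.continuous_comp_addCircle_coe (f : C(AddCircle T, V)) :
    Continuous fun t : ℝ => f (t : AddCircle T) :=
  f.continuous.comp continuous_quotient_mk'

theorem ContinuousMap.intervalIntegrable_addCircle (f : C(AddCircle T, V)) (a b : ℝ) :
    IntervalIntegrable (fun t : ℝ => f (t : AddCircle T)) MeasureTheory.volume a b :=
  f.continuous_comp_addCircle_coe.intervalIntegrable a b

theorem ContinuousMap.periodic_comp_addCircle_coe (f : C(AddCircle T, V)) :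
    Function.Periodic (fun t : ℝ => f (t : AddCircle T)) T := fun t => by
  simp

variable [NormedSpace ℝ V] [hT : Fact (0 < T)]

theorem ContinuousMap.norm_integral_addCircle_le (f : C(AddCircle T, V)) {t : ℝ}
    (ht : t ∈ Icc 0 T) : ‖∫ s in (0 : ℝ)..t, f (s : AddCircle T)‖ ≤ T * ‖f‖ := by
  have h := intervalIntegral.norm_integral_le_of_norm_le_const (a := 0) (b := t) (C := ‖f‖)
    (f := fun s : ℝ => f (s : AddCircle T)) fun s _ => f.norm_coe_le_norm _
  rw [sub_zero, abs_of_nonneg ht.1] at h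
  nlinarith [norm_nonneg f, ht.2]

/-- The integral of a continuous function over one period. -/
noncomputable def periodIntegral : C(AddCircle T, V) →L[ℝ] V :=
  LinearMap.mkContinuous
    { toFun := fun f => ∫ t in (0 : ℝ)..T, f (t : AddCircle T)
      map_add' := fun f g => by
        simpa using intervalIntegral.integral_add
          (f.intervalIntegrable_addCircle 0 T) (g.intervalIntegrable_addCircle 0 T)
      map_smul' := fun c f => by simp }
    T fun f => f.norm_integral_addCircle_le ⟨hT.out.le, le_rfl⟩

theorem periodIntegral_apply (f : C(AddCircle T, V)) :
    periodIntegral f = ∫ t in (0 : ℝ)..T, f (t : AddCircle T) := rfl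

theorem periodic_primitive (f : C(AddCircle T, V)) :
    Function.Periodic
      (fun t : ℝ => (∫ s in (0 : ℝ)..t, f (s : AddCircle T)) - (t / T) • periodIntegral f) T := by
  intro t
  have hT0 : T ≠ 0 := hT.out.ne'
  have h := f.periodic_comp_addCircle_coe.intervalIntegral_add_eq_add 0 t
    f.intervalIntegrable_addCircle
  rw [zero_add] at h
  simp only [periodIntegral_apply]
  rw [h, add_div, div_self hT0, add_smul, one_smul]
  abel

/-- The periodic primitive, vanishing at `0`, of a continuous periodic function
from which its mean has been subtracted. -/
noncomputable def periodicPrimitive : C(AddCircle T, V) →L[ℝ] C(AddCircle T, V) :=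
  LinearMap.mkContinuous
    { toFun := fun f =>
        { toFun := (periodic_primitive f).lift
          continuous_toFun := by
            refine Continuous.quotient_lift ?_ _
            exact (intervalIntegral.continuous_primitive f.intervalIntegrable_addCircle 0).sub
              (by fun_prop) }
      map_add' := fun f g => by
        ext x
        induction x using QuotientAddGroup.induction_on with
        | H t =>
          change (∫ s in (0 : ℝ)..t, (f s + g s)) - (t / T) • periodIntegral (f + g) =
            ((∫ s in (0 : ℝ)..t, f s) - (t / T) • periodIntegral f) +
            ((∫ s in (0 : ℝ)..t, g s) - (t / T) • periodIntegral g)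
          rw [intervalIntegral.integral_add (f.intervalIntegrable_addCircle 0 t)
            (g.intervalIntegrable_addCircle 0 t), map_add, smul_add]
          abel
      map_smul' := fun c f => by
        ext x
        induction x using QuotientAddGroup.induction_on with
        | H t =>
          change (∫ s in (0 : ℝ)..t, c • f s) - (t / T) • periodIntegral (c • f) =
            c • ((∫ s in (0 : ℝ)..t, f s) - (t / T) • periodIntegral f)
          rw [intervalIntegral.integral_smul, map_smul, smul_sub, smul_comm c] }
    (2 * T) fun f => by
      have hT0 := hT.out
      refine (ContinuousMap.norm_le _ (by positivity)).2 fun x => ?_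
      obtain ⟨t, ht, rfl⟩ := (AddCircle.coe_image_Icc_eq T (0 : ℝ)).ge (mem_univ x)
      rw [zero_add] at ht
      have h1 := f.norm_integral_addCircle_le ht
      have h2 := f.norm_integral_addCircle_le (right_mem_Icc.2 hT0.le)
      have h3 : t / T ≤ 1 := (div_le_one hT0).2 ht.2
      have h4 : 0 ≤ t / T := div_nonneg ht.1 hT0.le
      change ‖(∫ s in (0 : ℝ)..t, f (s : AddCircle T)) - (t / T) • periodIntegral f‖ ≤ _
      refine (norm_sub_le _ _).trans ?_
      rw [norm_smul, Real.norm_of_nonneg h4, periodIntegral_apply]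
      nlinarith [norm_nonneg (∫ t in (0 : ℝ)..T, f (t : AddCircle T))]

theorem periodicPrimitive_coe (f : C(AddCircle T, V)) (t : ℝ) :
    periodicPrimitive f (t : AddCircle T) =
      (∫ s in (0 : ℝ)..t, f (s : AddCircle T)) - (t / T) • periodIntegral f := rfl

theorem periodicPrimitive_zero (f : C(AddCircle T, V)) : periodicPrimitive f 0 = 0 := by
  have := periodicPrimitive_coe f 0
  simpa using this

/-- Continuous periodic functions with constant value, as a continuous linear map. -/
noncomputable def constCLM : V →L[ℝ] C(AddCircle T, V) :=
  LinearMap.mkContinuous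
    { toFun := ContinuousMap.const _
      map_add' := fun _ _ => rfl
      map_smul' := fun _ _ => rfl }
    1 fun v => by
      rw [one_mul]
      exact (ContinuousMap.norm_le _ (norm_nonneg v)).2 fun _ => le_rfl

@[simp] theorem constCLM_apply (v : V) (x : AddCircle T) : constCLM v x = v := rfl

/-- **Averaging**. The equation `w' = ε N(ε, w)` has, for small `ε`, periodic solutions
close to a nondegenerate zero of the averaged vector field. -/
theorem exists_periodic_of_averaging [CompleteSpace V]
    {N : ℝ × C(AddCircle T, V) → C(AddCircle T, V)} {p₀ : V} {L : V →L[ℝ] V}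
    (hN : ContDiffAt ℝ 1 N (0, constCLM p₀))
    (h₀ : periodIntegral (N (0, constCLM p₀)) = 0)
    (hL : HasFDerivAt (fun p => periodIntegral (N (0, constCLM p))) L p₀)
    (hbij : Function.Bijective L) :
    ∃ ψ : ℝ → C(AddCircle T, V), Tendsto ψ (𝓝 0) (𝓝 (constCLM p₀)) ∧
      ∀ᶠ ε in 𝓝 0, ∀ t : ℝ,
        HasDerivAt (fun s : ℝ => ψ ε (s : AddCircle T)) (ε • N (ε, ψ ε) (t : AddCircle T)) t := by
  obtain ⟨N', hN'⟩ : ∃ N', HasStrictFDerivAt N N' (0, constCLM p₀) :=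
    ⟨_, hN.hasStrictFDerivAt (by norm_num)⟩
  have hLN : ∀ p, periodIntegral (N' (0, constCLM p)) = L p := by
    have hc : HasFDerivAt (fun p : V => ((0 : ℝ), (constCLM p : C(AddCircle T, V))))
        ((0 : V →L[ℝ] ℝ).prod constCLM) p₀ :=
      (hasFDerivAt_const (0 : ℝ) p₀).prodMk (constCLM : V →L[ℝ] C(AddCircle T, V)).hasFDerivAt
    have h := periodIntegral.hasFDerivAt.comp p₀ (hN'.hasFDerivAt.comp p₀ hc)
    intro p
    rw [hL.unique h]
    rfl
  let ev : C(AddCircle T, V) →L[ℝ] V := ContinuousMap.evalCLM ℝ 0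
  have hev : ∀ w, ev w = w 0 := fun w => rfl
  let Φ : ℝ × C(AddCircle T, V) → C(AddCircle T, V) := fun q =>
    q.2 - constCLM (ev q.2) - q.1 • periodicPrimitive (N q) + constCLM (periodIntegral (N q))
  obtain ⟨Φ', hΦ, hΦ'⟩ : ∃ Φ' : ℝ × C(AddCircle T, V) →L[ℝ] C(AddCircle T, V),
      HasStrictFDerivAt Φ Φ' (0, constCLM p₀) ∧
      ∀ h, Φ' (0, h) = h - constCLM (h 0) + constCLM (periodIntegral (N' (0, h))) := by
    have hsnd : HasStrictFDerivAt (fun q : ℝ × C(AddCircle T, V) => q.2)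
      (ContinuousLinearMap.snd ℝ ℝ (C(AddCircle T, V))) (0, constCLM p₀) := hasStrictFDerivAt_snd
    have hfst : HasStrictFDerivAt (fun q : ℝ × C(AddCircle T, V) => q.1)
      (ContinuousLinearMap.fst ℝ ℝ (C(AddCircle T, V))) (0, constCLM p₀) := hasStrictFDerivAt_fst
    have hK := (periodicPrimitive (V := V) (T := T)).hasStrictFDerivAt.comp (0, constCLM p₀) hN'
    have hM := ((constCLM : V →L[ℝ] C(AddCircle T, V)).comp periodIntegral).hasStrictFDerivAt.comp
      (0, constCLM p₀) hN'
    have hE := ((constCLM : V →L[ℝ] C(AddCircle T, V)).comp ev).hasStrictFDerivAt.comp (0, constCLM p₀) hsnd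
    refine ⟨_, ((hsnd.sub hE).sub (hfst.smul hK)).add hM, fun h => ?_⟩
    simp [hev]
  have hinv : (Φ' ∘L .inr ℝ ℝ C(AddCircle T, V)).IsInvertible := by
    have happ : ∀ h, (Φ' ∘L .inr ℝ ℝ C(AddCircle T, V)) h =
        h - constCLM (h 0) + constCLM (periodIntegral (N' (0, h))) := fun h => hΦ' h
    have hinj : (Φ' ∘L .inr ℝ ℝ C(AddCircle T, V)).ker = ⊥ := by
      refine LinearMap.ker_eq_bot'.2 fun h hh => ?_
      have hh' : h - constCLM (h 0) + constCLM (periodIntegral (N' (0, h))) = 0 :=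
        (happ h).symm.trans hh
      have hz := DFunLike.congr_fun hh' 0
      simp only [ContinuousMap.add_apply, ContinuousMap.sub_apply, constCLM_apply, sub_self,
        zero_add, ContinuousMap.zero_apply] at hz
      rw [hz, map_zero constCLM, add_zero, sub_eq_zero] at hh'
      rw [hh', hLN] at hz
      rw [hh', hbij.1 (hz.trans (map_zero L).symm), map_zero]
    have hsurj : (Φ' ∘L .inr ℝ ℝ C(AddCircle T, V)).range = ⊤ := by
      refine LinearMap.range_eq_top.2 fun k => ?_
      obtain ⟨p, hp⟩ := hbij.2 (k 0 - periodIntegral (N' (0, k - constCLM (k 0))))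
      refine ⟨k - constCLM (k 0) + constCLM p, ?_⟩
      refine (happ _).trans ?_
      have hsplit : ((0 : ℝ), k - constCLM (k 0) + constCLM p) =
          (0, k - constCLM (k 0)) + (0, constCLM p) := by simp
      rw [hsplit, map_add, map_add, hLN, hp]
      ext x
      simp
    exact ⟨ContinuousLinearEquiv.ofBijective _ hinj hsurj, rfl⟩
  refine ⟨hΦ.implicitFunctionOfProdDomain hinv,
    hΦ.tendsto_implicitFunctionOfProdDomain hinv, ?_⟩
  filter_upwards [hΦ.eventually_apply_implicitFunctionOfProdDomain hinv] with ε hε t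
  set w := hΦ.implicitFunctionOfProdDomain hinv ε
  have hΦ₀ : Φ (0, constCLM p₀) = 0 := by
    ext x
    simp [Φ, h₀, hev]
  rw [hΦ₀] at hε
  have hmean : periodIntegral (N (ε, w)) = 0 := by
    have := DFunLike.congr_fun hε 0
    simpa [Φ, hev, periodicPrimitive_zero] using this
  have hw : ∀ s : ℝ, w (s : AddCircle T) =
      w 0 + ε • ∫ τ in (0 : ℝ)..s, N (ε, w) (τ : AddCircle T) := by
    intro s
    have := DFunLike.congr_fun hε (s : AddCircle T)
    simp only [Φ, hev, hmean, map_zero, add_zero, ContinuousMap.sub_apply, constCLM_apply,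
      ContinuousMap.smul_apply, periodicPrimitive_coe, smul_zero, sub_zero,
      ContinuousMap.zero_apply] at this
    rw [sub_sub, sub_eq_zero] at this
    exact this
  rw [funext hw]
  have hcont := (N (ε, w)).continuous_comp_addCircle_coe
  exact ((intervalIntegral.integral_hasDerivAt_right
    ((N (ε, w)).intervalIntegrable_addCircle 0 t)
    hcont.stronglyMeasurable.stronglyMeasurableAtFilter hcont.continuousAt).const_smul ε).const_add _

end Averaging

theorem integral_cos_sin_sextic (A B C D E F G : ℝ) :
    ∫ t in (0 : ℝ)..(2 * Real.pi), (A * Real.cos t ^ 6 + B * (Real.cos t ^ 5 * Real.sin t) +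
      C * (Real.cos t ^ 4 * Real.sin t ^ 2) + D * (Real.cos t ^ 3 * Real.sin t ^ 3) +
      E * (Real.cos t ^ 2 * Real.sin t ^ 4) + F * (Real.cos t * Real.sin t ^ 5) +
      G * Real.sin t ^ 6) = Real.pi / 8 * (5 * A + C + E + 5 * G) := by
  let P : ℝ → ℝ := fun t =>
    A * (Real.cos t ^ 5 * Real.sin t / 6 + 5 / 24 * Real.cos t ^ 3 * Real.sin t
      + 5 / 16 * Real.cos t * Real.sin t + 5 / 16 * t)
    - B * (Real.cos t ^ 6 / 6)
    + C * (Real.cos t ^ 3 * Real.sin t ^ 3 / 6 + Real.cos t * Real.sin t ^ 3 / 8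
      - Real.cos t * Real.sin t / 16 + t / 16)
    + D * (Real.sin t ^ 4 / 4 - Real.sin t ^ 6 / 6)
    + E * (Real.sin t ^ 5 * Real.cos t / 6 - Real.sin t ^ 3 * Real.cos t / 24
      - Real.cos t * Real.sin t / 16 + t / 16)
    + F * (Real.sin t ^ 6 / 6)
    + G * (-(Real.sin t ^ 5 * Real.cos t / 6) - 5 / 24 * Real.sin t ^ 3 * Real.cos t
      - 5 / 16 * Real.cos t * Real.sin t + 5 / 16 * t)
  have hP : ∀ t, HasDerivAt P (A * Real.cos t ^ 6 + B * (Real.cos t ^ 5 * Real.sin t) +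
      C * (Real.cos t ^ 4 * Real.sin t ^ 2) + D * (Real.cos t ^ 3 * Real.sin t ^ 3) +
      E * (Real.cos t ^ 2 * Real.sin t ^ 4) + F * (Real.cos t * Real.sin t ^ 5) +
      G * Real.sin t ^ 6) t := by
    intro t
    have hs := Real.hasDerivAt_sin t
    have hc := Real.hasDerivAt_cos t
    have ht := hasDerivAt_id t
    have hA := ((((((hc.pow 5).mul hs).div_const 6).add
      (((hc.pow 3).const_mul (5 / 24)).mul hs)).add
      ((hc.const_mul (5 / 16)).mul hs)).add (ht.const_mul (5 / 16))).const_mul A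
    have hB := ((hc.pow 6).div_const 6).const_mul B
    have hC := ((((((hc.pow 3).mul (hs.pow 3)).div_const 6).add
      ((hc.mul (hs.pow 3)).div_const 8)).sub ((hc.mul hs).div_const 16)).add
      (ht.div_const 16)).const_mul C
    have hD := (((hs.pow 4).div_const 4).sub ((hs.pow 6).div_const 6)).const_mul D
    have hE := ((((((hs.pow 5).mul hc).div_const 6).sub
      (((hs.pow 3).mul hc).div_const 24)).sub ((hc.mul hs).div_const 16)).add
      (ht.div_const 16)).const_mul E
    have hF := ((hs.pow 6).div_const 6).const_mul F
    have hG := (((((((hs.pow 5).mul hc).div_const 6).neg).sub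
      (((hs.pow 3).const_mul (5 / 24)).mul hc)).sub
      ((hc.const_mul (5 / 16)).mul hs)).add (ht.const_mul (5 / 16))).const_mul G
    refine ((((((hA.sub hB).add hC).add hD).add hE).add hF).add hG).congr_deriv ?_
    have h : Real.sin t ^ 2 = 1 - Real.cos t ^ 2 := Real.sin_sq t
    have h3 : Real.sin t ^ 3 = (1 - Real.cos t ^ 2) * Real.sin t := by rw [← h]; ring
    have h4 : Real.sin t ^ 4 = (1 - Real.cos t ^ 2) ^ 2 := by rw [← h]; ring
    have h5 : Real.sin t ^ 5 = (1 - Real.cos t ^ 2) ^ 2 * Real.sin t := by rw [← h]; ring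
    have h6 : Real.sin t ^ 6 = (1 - Real.cos t ^ 2) ^ 3 := by rw [← h]; ring
    norm_num
    ring_nf
    simp only [h, h3, h4, h5, h6]
    ring
  rw [intervalIntegral.integral_eq_sub_of_hasDerivAt (fun t _ => hP t)
    (Continuous.intervalIntegrable (by fun_prop) _ _)]
  simp [P]
  ring

theorem integral_averaged_quintic (l d u v α β : ℝ) :
    ∫ t in (0 : ℝ)..(2 * Real.pi),
      (d * Real.cos t - l * (u * Real.cos t + v * Real.sin t) ^ 5) *
        (α * Real.cos t + β * Real.sin t) =
      Real.pi * (d * α - 5 / 8 * l * (u ^ 2 + v ^ 2) ^ 2 * (α * u + β * v)) := by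
  have h := integral_cos_sin_sextic (d * α - l * u ^ 5 * α)
    (d * β - l * (u ^ 5 * β + 5 * u ^ 4 * v * α))
    (2 * d * α - l * (5 * u ^ 4 * v * β + 10 * u ^ 3 * v ^ 2 * α))
    (2 * d * β - l * (10 * u ^ 3 * v ^ 2 * β + 10 * u ^ 2 * v ^ 3 * α))
    (d * α - l * (10 * u ^ 2 * v ^ 3 * β + 5 * u * v ^ 4 * α))
    (d * β - l * (5 * u * v ^ 4 * β + v ^ 5 * α)) (-(l * v ^ 5 * β))
  refine Eq.trans (intervalIntegral.integral_congr fun t _ => ?_) (h.trans (by ring))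
  have h1 : d * Real.cos t = d * Real.cos t * (Real.cos t ^ 2 + Real.sin t ^ 2) ^ 2 := by
    rw [Real.cos_sq_add_sin_sq]; ring
  rw [h1]
  ring

theorem exists_pow_five_eq (y : ℝ) : ∃ c : ℝ, c ^ 5 = y := by
  have htop : Filter.Tendsto (fun x : ℝ => x ^ 5) Filter.atTop Filter.atTop :=
    Filter.tendsto_pow_atTop (by norm_num)
  have hbot : Filter.Tendsto (fun x : ℝ => x ^ 5) Filter.atBot Filter.atBot := by
    refine (Filter.tendsto_neg_atTop_atBot.comp
      (htop.comp Filter.tendsto_neg_atBot_atTop)).congr fun x => ?_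
    simp only [Function.comp_apply]
    ring
  exact (continuous_pow 5).surjective htop hbot y

section Duffing

instance fact_two_pi_pos : Fact (0 < 2 * Real.pi) := ⟨Real.two_pi_pos⟩

/-- Cosine as a continuous function on the circle of length `2π`. -/
noncomputable def circleCos : C(AddCircle (2 * Real.pi), ℝ) :=
  { toFun := Real.cos_periodic.lift
    continuous_toFun := Continuous.quotient_lift Real.continuous_cos _ }

/-- Sine as a continuous function on the circle of length `2π`. -/
noncomputable def circleSin : C(AddCircle (2 * Real.pi), ℝ) :=
  { toFun := Real.sin_periodic.lift
    continuous_toFun := Continuous.quotient_lift Real.continuous_sin _ }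

@[simp] theorem circleCos_coe (t : ℝ) : circleCos (t : AddCircle (2 * Real.pi)) = Real.cos t := rfl

@[simp] theorem circleSin_coe (t : ℝ) : circleSin (t : AddCircle (2 * Real.pi)) = Real.sin t := rfl

theorem periodIntegral_compLeftContinuous {V W : Type*} [NormedAddCommGroup V] [NormedSpace ℝ V]
    [CompleteSpace V] [NormedAddCommGroup W] [NormedSpace ℝ W] [CompleteSpace W] {T : ℝ}
    [Fact (0 < T)] (L : V →L[ℝ] W) (f : C(AddCircle T, V)) :
    periodIntegral (L.compLeftContinuous ℝ (AddCircle T) f) = L (periodIntegral f) :=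
  L.intervalIntegral_comp_comm (f.intervalIntegrable_addCircle 0 T)

/-- The `x`-coordinate of a periodic curve given in rotating coordinates. -/
noncomputable def rotX :
    C(AddCircle (2 * Real.pi), ℝ × ℝ) → C(AddCircle (2 * Real.pi), ℝ) := fun w =>
  (ContinuousLinearMap.fst ℝ ℝ ℝ).compLeftContinuous ℝ _ w * circleCos +
    (ContinuousLinearMap.snd ℝ ℝ ℝ).compLeftContinuous ℝ _ w * circleSin

/-- The `y`-coordinate of a periodic curve given in rotating coordinates. -/
noncomputable def rotY :
    C(AddCircle (2 * Real.pi), ℝ × ℝ) → C(AddCircle (2 * Real.pi), ℝ) := fun w =>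
  (ContinuousLinearMap.snd ℝ ℝ ℝ).compLeftContinuous ℝ _ w * circleCos -
    (ContinuousLinearMap.fst ℝ ℝ ℝ).compLeftContinuous ℝ _ w * circleSin

@[simp] theorem rotX_coe (w : C(AddCircle (2 * Real.pi), ℝ × ℝ)) (t : ℝ) :
    rotX w (t : AddCircle (2 * Real.pi)) =
      (w (t : AddCircle (2 * Real.pi))).1 * Real.cos t +
        (w (t : AddCircle (2 * Real.pi))).2 * Real.sin t := rfl

@[simp] theorem rotY_coe (w : C(AddCircle (2 * Real.pi), ℝ × ℝ)) (t : ℝ) :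
    rotY w (t : AddCircle (2 * Real.pi)) =
      (w (t : AddCircle (2 * Real.pi))).2 * Real.cos t -
        (w (t : AddCircle (2 * Real.pi))).1 * Real.sin t := rfl

theorem contDiff_rotX : ContDiff ℝ 1 rotX := by
  unfold rotX
  fun_prop

theorem contDiff_rotY : ContDiff ℝ 1 rotY := by
  unfold rotY
  fun_prop

/-- The perturbing force of the Duffing–Van der Pol oscillator, divided by `ε`. -/
noncomputable def duffingForce (l d r a : ℝ) (m₁ m₂ : ℕ)
    (q : ℝ × C(AddCircle (2 * Real.pi), ℝ × ℝ)) : C(AddCircle (2 * Real.pi), ℝ) :=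
  (q.1 ^ m₁ * r) • (rotY q.2 - rotX q.2 ^ 2 * rotY q.2) - (q.1 ^ m₂ * a) • rotX q.2 ^ 3
    - l • rotX q.2 ^ 5 + d • circleCos

/-- The Duffing–Van der Pol vector field in rotating coordinates, divided by `ε`. -/
noncomputable def duffingField (l d r a : ℝ) (m₁ m₂ : ℕ)
    (q : ℝ × C(AddCircle (2 * Real.pi), ℝ × ℝ)) : C(AddCircle (2 * Real.pi), ℝ × ℝ) :=
  (ContinuousLinearMap.inr ℝ ℝ ℝ).compLeftContinuous ℝ _ (duffingForce l d r a m₁ m₂ q * circleCos) -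
    (ContinuousLinearMap.inl ℝ ℝ ℝ).compLeftContinuous ℝ _ (duffingForce l d r a m₁ m₂ q * circleSin)

theorem contDiff_duffingField (l d r a : ℝ) (m₁ m₂ : ℕ) :
    ContDiff ℝ 1 (duffingField l d r a m₁ m₂) := by
  have hX := contDiff_rotX
  have hY := contDiff_rotY
  have hF : ContDiff ℝ 1 (duffingForce l d r a m₁ m₂) := by
    unfold duffingForce
    fun_prop
  unfold duffingField
  fun_prop

theorem duffingForce_coe (l d r a : ℝ) (m₁ m₂ : ℕ) (ε : ℝ)
    (w : C(AddCircle (2 * Real.pi), ℝ × ℝ)) (t : ℝ) :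
    duffingForce l d r a m₁ m₂ (ε, w) (t : AddCircle (2 * Real.pi)) =
      ε ^ m₁ * r * (rotY w (t : AddCircle (2 * Real.pi)) -
        rotX w (t : AddCircle (2 * Real.pi)) ^ 2 * rotY w (t : AddCircle (2 * Real.pi))) -
      ε ^ m₂ * a * rotX w (t : AddCircle (2 * Real.pi)) ^ 3 -
      l * rotX w (t : AddCircle (2 * Real.pi)) ^ 5 + d * Real.cos t := rfl

theorem duffingField_coe (l d r a : ℝ) (m₁ m₂ : ℕ) (q : ℝ × C(AddCircle (2 * Real.pi), ℝ × ℝ))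
    (t : ℝ) :
    duffingField l d r a m₁ m₂ q (t : AddCircle (2 * Real.pi)) =
      (-(duffingForce l d r a m₁ m₂ q (t : AddCircle (2 * Real.pi)) * Real.sin t),
        duffingForce l d r a m₁ m₂ q (t : AddCircle (2 * Real.pi)) * Real.cos t) := by
  simp [duffingField]

theorem periodIntegral_duffingField (l d r a : ℝ) {m₁ m₂ : ℕ} (h₁ : m₁ ≠ 0) (h₂ : m₂ ≠ 0)
    (p : ℝ × ℝ) :
    periodIntegral (duffingField l d r a m₁ m₂ (0, constCLM p)) =
      (5 / 8 * Real.pi * l * ((p.1 ^ 2 + p.2 ^ 2) ^ 2 * p.2),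
        Real.pi * d - 5 / 8 * Real.pi * l * ((p.1 ^ 2 + p.2 ^ 2) ^ 2 * p.1)) := by
  have hforce (t : ℝ) : duffingForce l d r a m₁ m₂ (0, constCLM p) (t : AddCircle (2 * Real.pi)) =
      d * Real.cos t - l * (p.1 * Real.cos t + p.2 * Real.sin t) ^ 5 := by
    rw [duffingForce_coe, zero_pow h₁, zero_pow h₂]
    simp
    ring
  have hc := integral_averaged_quintic l d p.1 p.2 1 0
  have hs := integral_averaged_quintic l d p.1 p.2 0 1
  have hc' : periodIntegral (duffingForce l d r a m₁ m₂ (0, constCLM p) * circleCos) =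
      Real.pi * d - 5 / 8 * Real.pi * l * ((p.1 ^ 2 + p.2 ^ 2) ^ 2 * p.1) := by
    simp only [periodIntegral_apply, ContinuousMap.mul_apply, hforce, circleCos_coe]
    simp only [one_mul, zero_mul, add_zero] at hc
    rw [hc]
    ring
  have hs' : periodIntegral (duffingForce l d r a m₁ m₂ (0, constCLM p) * circleSin) =
      -(5 / 8 * Real.pi * l * ((p.1 ^ 2 + p.2 ^ 2) ^ 2 * p.2)) := by
    simp only [periodIntegral_apply, ContinuousMap.mul_apply, hforce, circleSin_coe]
    simp only [one_mul, zero_mul, zero_add] at hs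
    rw [hs]
    ring
  rw [duffingField, map_sub, periodIntegral_compLeftContinuous, periodIntegral_compLeftContinuous,
    hc', hs']
  simp

theorem exists_bijective_hasFDerivAt_averaged {k : ℝ} (hk : k ≠ 0) {c : ℝ} (hc : c ≠ 0) (e : ℝ) :
    ∃ L : ℝ × ℝ →L[ℝ] ℝ × ℝ, Function.Bijective L ∧
      HasFDerivAt (fun p : ℝ × ℝ => (k * ((p.1 ^ 2 + p.2 ^ 2) ^ 2 * p.2),
        e - k * ((p.1 ^ 2 + p.2 ^ 2) ^ 2 * p.1))) L (c, 0) := by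
  have hfst : HasFDerivAt (fun p : ℝ × ℝ => p.1) (ContinuousLinearMap.fst ℝ ℝ ℝ) (c, 0) :=
    hasFDerivAt_fst
  have hsnd : HasFDerivAt (fun p : ℝ × ℝ => p.2) (ContinuousLinearMap.snd ℝ ℝ ℝ) (c, 0) :=
    hasFDerivAt_snd
  have hR := ((hfst.pow 2).add (hsnd.pow 2)).pow 2
  have hD := ((hR.mul hsnd).const_mul k).prodMk (((hR.mul hfst).const_mul k).const_sub e)
  have hkc : k * c ^ 4 ≠ 0 := mul_ne_zero hk (pow_ne_zero 4 hc)
  refine ⟨_, ?_, hD⟩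
  refine Function.bijective_iff_has_inverse.2
    ⟨fun p => (-p.2 / (5 * (k * c ^ 4)), p.1 / (k * c ^ 4)), fun p => ?_, fun p => ?_⟩
  · ext <;> simp <;> field_simp; ring
  · ext <;> simp <;> field_simp; ring

end Duffing

/-- Theorem 3 of the paper.
For `(λ, δ, ρ, α) = (εℓ, εd, ε^{n₁}r, ε^{n₂}a)` with `n₁, n₂ > 1` and `ℓ ≠ 0`,
the system has a `2π`-periodic solution whose initial condition tends to
`((8d/(5ℓ))^{1/5}, 0)` as `ε → 0⁺`.  The real fifth root is characterised by
its fifth power: `c ^ 5 = 8d/(5ℓ)`. -/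
theorem stmt_2 (l d r a : ℝ) (n₁ n₂ : ℤ)
    (hl : l ≠ 0) (hd : 0 < d) (hn₁ : 1 < n₁) (hn₂ : 1 < n₂)
    (hr : 0 ≤ r) :
    ∃ c : ℝ, c ^ 5 = 8 * d / (5 * l) ∧
      ∃ ε₀ > (0 : ℝ), ∃ X Y : ℝ → ℝ → ℝ,
        (∀ ε ∈ Set.Ioo (0 : ℝ) ε₀,
          (∀ t, HasDerivAt (X ε) (Y ε t) t) ∧
          (∀ t, HasDerivAt (Y ε)
            (-(X ε t) + ε ^ n₁ * r * Y ε t - ε ^ n₁ * r * (X ε t) ^ 2 * Y ε t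
              - ε ^ n₂ * a * (X ε t) ^ 3 - ε * l * (X ε t) ^ 5
              + ε * d * Real.cos t) t) ∧
          (∀ t, X ε (t + 2 * Real.pi) = X ε t) ∧
          (∀ t, Y ε (t + 2 * Real.pi) = Y ε t)) ∧
        Filter.Tendsto (fun ε => (X ε 0, Y ε 0)) (nhdsWithin 0 (Set.Ioi 0))
          (nhds (c, (0 : ℝ))) := by
  obtain ⟨c, hc⟩ := exists_pow_five_eq (8 * d / (5 * l))
  refine ⟨c, hc, ?_⟩
  obtain ⟨m₁, rfl⟩ : ∃ m : ℕ, n₁ = (m : ℤ) + 1 := ⟨(n₁ - 1).toNat, by lia⟩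
  obtain ⟨m₂, rfl⟩ : ∃ m : ℕ, n₂ = (m : ℤ) + 1 := ⟨(n₂ - 1).toNat, by lia⟩
  have h₁ : m₁ ≠ 0 := by lia
  have h₂ : m₂ ≠ 0 := by lia
  have hc0 : c ≠ 0 := by
    rintro rfl
    have : 8 * d / (5 * l) ≠ 0 := by positivity
    exact this (by rw [← hc]; norm_num)
  have hpi := Real.pi_ne_zero
  obtain ⟨L, hbij, hL⟩ := exists_bijective_hasFDerivAt_averaged
    (k := 5 / 8 * Real.pi * l) (by positivity) hc0 (Real.pi * d)
  have hmean : periodIntegral (duffingField l d r a m₁ m₂ (0, constCLM (c, 0))) = 0 := by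
    rw [periodIntegral_duffingField l d r a h₁ h₂]
    have : 5 * l * c ^ 5 = 8 * d := by rw [hc]; field_simp
    ext
    · simp
    · simp only [Prod.snd_zero]
      linear_combination (-Real.pi / 8) * this
  obtain ⟨ψ, hψ, hev⟩ := exists_periodic_of_averaging
    (contDiff_duffingField l d r a m₁ m₂).contDiffAt hmean
    (by simpa only [periodIntegral_duffingField l d r a h₁ h₂] using hL) hbij
  obtain ⟨ε₀, hε₀, hball⟩ := Metric.eventually_nhds_iff.1 hev
  refine ⟨ε₀, hε₀, fun ε t => rotX (ψ ε) (t : AddCircle (2 * Real.pi)),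
    fun ε t => rotY (ψ ε) (t : AddCircle (2 * Real.pi)), ?_, ?_⟩
  · intro ε hε
    have hode := hball (y := ε) (by simpa [abs_of_pos hε.1] using hε.2)
    have hu (t : ℝ) := (ContinuousLinearMap.fst ℝ ℝ ℝ).hasFDerivAt.comp_hasDerivAt t (hode t)
    have hv (t : ℝ) := (ContinuousLinearMap.snd ℝ ℝ ℝ).hasFDerivAt.comp_hasDerivAt t (hode t)
    simp only [duffingField_coe, Prod.smul_mk, smul_eq_mul, ContinuousLinearMap.coe_fst',
      ContinuousLinearMap.coe_snd', Function.comp_def] at hu hv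
    refine ⟨fun t => ?_, fun t => ?_, fun t => by simp, fun t => by simp⟩
    · simp only [rotX_coe]
      refine (((hu t).mul (Real.hasDerivAt_cos t)).add
        ((hv t).mul (Real.hasDerivAt_sin t))).congr_deriv ?_
      rw [rotY_coe]
      ring
    · have hz₁ : ε ^ ((m₁ : ℤ) + 1) = ε ^ m₁ * ε := by exact_mod_cast pow_succ ε m₁
      have hz₂ : ε ^ ((m₂ : ℤ) + 1) = ε ^ m₂ * ε := by exact_mod_cast pow_succ ε m₂
      have hY : HasDerivAt (fun t : ℝ => rotY (ψ ε) (t : AddCircle (2 * Real.pi)))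
          (-rotX (ψ ε) (t : AddCircle (2 * Real.pi)) +
            ε * duffingForce l d r a m₁ m₂ (ε, ψ ε) (t : AddCircle (2 * Real.pi))) t := by
        simp only [rotY_coe]
        refine (((hv t).mul (Real.hasDerivAt_cos t)).sub
          ((hu t).mul (Real.hasDerivAt_sin t))).congr_deriv ?_
        rw [rotX_coe]
        linear_combination (ε * duffingForce l d r a m₁ m₂ (ε, ψ ε)
          (t : AddCircle (2 * Real.pi))) * Real.sin_sq_add_cos_sq t
      refine hY.congr_deriv ?_
      rw [duffingForce_coe, hz₁, hz₂]
      ring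
  · have hX0 (ε : ℝ) : (rotX (ψ ε) ((0 : ℝ) : AddCircle (2 * Real.pi)),
        rotY (ψ ε) ((0 : ℝ) : AddCircle (2 * Real.pi))) = ψ ε 0 := by
      rw [rotX_coe, rotY_coe]
      simp
    simp only [hX0]
    have h := ((continuous_eval_const (0 : AddCircle (2 * Real.pi))).tendsto
      (constCLM (c, (0 : ℝ)))).comp hψ
    exact h.mono_left nhdsWithin_le_nhds
end

section
/- Let r > 0 and d > 0 be real numbers, let n₂, n₃ be positive integers, and let a, ℓ be real with ℓ ≠ 0. Then there exists ε₀ > 0 such that for every ε ∈ (0, ε₀) the rescaled system Ẋ = Y, Ẏ = −X + ε r Y − ε³ r X² Y − ε^{n₂+2} a X³ − ε^{n₃+4} ℓ X⁵ + ε d cos t has a 2π-periodic solution (X(t,ε), Y(t,ε)), and these solutions can be chosen so that (X(0,ε), Y(0,ε)) → (0, −d/r) as ε → 0⁺. (In the original variables x = εX, y = εY this is a periodic solution of system (4) with (x(0,ε), y(0,ε)) = (O(ε), −δ/(ερ) + O(ε)).) -/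
/-- The `2π`-periodic solution operator of the linear equation `z' = μ z + g`. -/
noncomputable def periodicSolution (μ : ℂ) (g : ℝ → ℂ) (t : ℝ) : ℂ :=
  (Complex.exp (-μ * (2 * Real.pi : ℝ)) - 1)⁻¹ *
    ∫ s in (0 : ℝ)..(2 * Real.pi), Complex.exp (-μ * s) * g (t + s)

theorem periodicSolution_add_two_pi {μ : ℂ} {g : ℝ → ℂ}
    (hg : ∀ t, g (t + 2 * Real.pi) = g t) (t : ℝ) :
    periodicSolution μ g (t + 2 * Real.pi) = periodicSolution μ g t := by
  simp only [periodicSolution]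
  congr 2
  funext s
  rw [add_right_comm, hg]

theorem hasDerivAt_periodicSolution {μ : ℂ} {g : ℝ → ℂ} (hgc : Continuous g)
    (hg : ∀ t, g (t + 2 * Real.pi) = g t)
    (hμ : Complex.exp (-μ * (2 * Real.pi : ℝ)) - 1 ≠ 0) (t : ℝ) :
    HasDerivAt (periodicSolution μ g) (μ * periodicSolution μ g t + g t) t := by
  let h : ℝ → ℂ := fun s => Complex.exp (-μ * s) * g s
  have hh : Continuous h := by fun_prop
  have hform : ∀ t, periodicSolution μ g t = (Complex.exp (-μ * (2 * Real.pi : ℝ)) - 1)⁻¹ *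
      (Complex.exp (μ * t) *
        ((∫ s in (0 : ℝ)..(t + 2 * Real.pi), h s) - ∫ s in (0 : ℝ)..t, h s)) := by
    intro t
    rw [intervalIntegral.integral_interval_sub_left (hh.intervalIntegrable _ _)
      (hh.intervalIntegrable _ _)]
    have := intervalIntegral.integral_comp_add_left (a := 0) (b := 2 * Real.pi) h t
    rw [add_zero] at this
    rw [← this, periodicSolution, ← intervalIntegral.integral_const_mul (Complex.exp (μ * t))]
    congr 2
    funext s
    simp only [h]
    rw [← mul_assoc, ← Complex.exp_add]
    congr 2
    push_cast
    ring
  have hF : ∀ t, HasDerivAt (fun t => ∫ s in (0 : ℝ)..t, h s) (h t) t := fun t =>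
    intervalIntegral.integral_hasDerivAt_right (hh.intervalIntegrable _ _)
      (hh.stronglyMeasurableAtFilter _ _) hh.continuousAt
  have hexp : HasDerivAt (fun t : ℝ => Complex.exp (μ * t)) (Complex.exp (μ * t) * μ) t := by
    have h1 : HasDerivAt (fun t : ℝ => μ * (t : ℂ)) (μ * 1) t :=
      (Complex.ofRealCLM.hasDerivAt (x := t)).const_mul μ
    simpa using h1.cexp
  have hd := (hexp.mul (((hF (t + 2 * Real.pi)).comp_add_const t (2 * Real.pi)).sub
    (hF t))).const_mul (Complex.exp (-μ * (2 * Real.pi : ℝ)) - 1)⁻¹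
  rw [show periodicSolution μ g = _ from funext hform]
  refine hd.congr_deriv ?_
  have e1 : Complex.exp (μ * t) * (h (t + 2 * Real.pi) - h t) =
      (Complex.exp (-μ * (2 * Real.pi : ℝ)) - 1) * g t := by
    simp only [h, hg]
    rw [mul_sub, ← mul_assoc, ← mul_assoc, ← Complex.exp_add, ← Complex.exp_add, sub_mul]
    congr 3
    · push_cast
      ring
    · rw [neg_mul, add_neg_cancel, Complex.exp_zero]
  simp only [Pi.sub_apply]
  rw [e1, mul_add, inv_mul_cancel_left₀ hμ]
  ring

theorem norm_periodicSolution_le {μ : ℂ} (hμ : 0 ≤ μ.re) {c M : ℝ} (hc : 0 < c)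
    (hcμ : c ≤ ‖Complex.exp (-μ * (2 * Real.pi : ℝ)) - 1‖) {g : ℝ → ℂ}
    (hg : ∀ t, ‖g t‖ ≤ M) (t : ℝ) :
    ‖periodicSolution μ g t‖ ≤ c⁻¹ * (M * (2 * Real.pi)) := by
  have hM : 0 ≤ M := (norm_nonneg _).trans (hg 0)
  have h2 : ‖∫ s in (0 : ℝ)..(2 * Real.pi), Complex.exp (-μ * s) * g (t + s)‖
      ≤ M * |2 * Real.pi - 0| := by
    refine intervalIntegral.norm_integral_le_of_norm_le_const fun s hs => ?_
    rw [Set.uIoc_of_le (by positivity)] at hs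
    rw [norm_mul, Complex.norm_exp]
    have : Real.exp (-μ * s).re ≤ 1 := by
      rw [Real.exp_le_one_iff]
      simpa using mul_nonneg hμ hs.1.le
    calc _ ≤ 1 * M := by gcongr; exact hg _
      _ = M := one_mul M
  rw [sub_zero, abs_of_pos (by positivity)] at h2
  rw [periodicSolution, norm_mul, norm_inv]
  gcongr

theorem periodicSolution_sub (μ : ℂ) {g₁ g₂ : ℝ → ℂ} (h₁ : Continuous g₁) (h₂ : Continuous g₂)
    (t : ℝ) : periodicSolution μ g₁ t - periodicSolution μ g₂ t =
      periodicSolution μ (fun s => g₁ s - g₂ s) t := by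
  simp only [periodicSolution]
  rw [← mul_sub, ← intervalIntegral.integral_sub (Continuous.intervalIntegrable (by fun_prop) _ _)
    (Continuous.intervalIntegrable (by fun_prop) _ _)]
  simp only [mul_sub]

/-- A small `2π`-periodic Lipschitz perturbation of `z' = μ z` has a small periodic solution. -/
theorem exists_periodic_solution {μ : ℂ} (hμ : 0 ≤ μ.re) {c R M K : ℝ} (hc : 0 < c)
    (hcμ : c ≤ ‖Complex.exp (-μ * (2 * Real.pi : ℝ)) - 1‖) (hR : 0 ≤ R) (hK : 0 ≤ K)
    {F : ℝ → ℂ → ℂ} (hF : Continuous fun p : ℝ × ℂ => F p.1 p.2)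
    (hper : ∀ t z, F (t + 2 * Real.pi) z = F t z)
    (hM : ∀ t z, ‖z‖ ≤ R → ‖F t z‖ ≤ M)
    (hL : ∀ t z w, ‖z‖ ≤ R → ‖w‖ ≤ R → ‖F t z - F t w‖ ≤ K * ‖z - w‖)
    (hMR : M * (2 * Real.pi) ≤ c * R) (hKc : K * (2 * Real.pi) < c) :
    ∃ z : ℝ → ℂ, (∀ t, ‖z t‖ ≤ R) ∧ (∀ t, z (t + 2 * Real.pi) = z t) ∧
      ∀ t, HasDerivAt z (μ * z t + F t (z t)) t := by
  let S : Set (BoundedContinuousFunction ℝ ℂ) :=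
    {z | (∀ t, ‖z t‖ ≤ R) ∧ ∀ t, z (t + 2 * Real.pi) = z t}
  have hS : IsClosed S := by
    simp only [S, Set.ofPred_and, Set.ofPred_forall]
    refine (isClosed_iInter fun t => ?_).inter (isClosed_iInter fun t => ?_)
    · exact isClosed_le (continuous_eval_const _).norm continuous_const
    · exact isClosed_eq (continuous_eval_const _) (continuous_eval_const _)
  have : CompleteSpace S := hS.completeSpace_coe
  have : Nonempty S := ⟨⟨0, by simp [S, hR]⟩⟩
  have hμ0 : Complex.exp (-μ * (2 * Real.pi : ℝ)) - 1 ≠ 0 := norm_pos_iff.1 (hc.trans_le hcμ)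
  have hgc : ∀ z : S, Continuous fun t => F t (z.1 t) := fun z =>
    hF.comp (continuous_id.prodMk z.1.continuous)
  have hgp : ∀ z : S, ∀ t, F (t + 2 * Real.pi) (z.1 (t + 2 * Real.pi)) = F t (z.1 t) := by
    intro z t
    rw [z.2.2, hper]
  have hderiv : ∀ z : S, ∀ t, HasDerivAt (periodicSolution μ fun t => F t (z.1 t))
      (μ * periodicSolution μ (fun t => F t (z.1 t)) t + F t (z.1 t)) t := fun z =>
    hasDerivAt_periodicSolution (hgc z) (hgp z) hμ0
  have hbound : ∀ z : S, ∀ t, ‖periodicSolution μ (fun t => F t (z.1 t)) t‖ ≤ R := by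
    intro z t
    refine (norm_periodicSolution_le hμ hc hcμ (fun t => hM t _ (z.2.1 t)) t).trans ?_
    rwa [inv_mul_le_iff₀ hc]
  let T : S → S := fun z => ⟨BoundedContinuousFunction.ofNormedAddCommGroup
    (periodicSolution μ fun t => F t (z.1 t))
    (continuous_iff_continuousAt.2 fun t => (hderiv z t).continuousAt) R (hbound z),
    hbound z, fun t => periodicSolution_add_two_pi (g := fun t => F t (z.1 t)) (hgp z) t⟩
  have hT : ContractingWith (Real.toNNReal (c⁻¹ * (K * (2 * Real.pi)))) T := by
    refine ⟨?_, LipschitzWith.of_dist_le_mul fun z w => ?_⟩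
    · rw [Real.toNNReal_lt_one, inv_mul_lt_iff₀ hc, mul_one]
      exact hKc
    · rw [Real.coe_toNNReal _ (by positivity), Subtype.dist_eq, Subtype.dist_eq]
      refine (BoundedContinuousFunction.dist_le (by positivity)).2 fun t => ?_
      change dist (periodicSolution μ (fun t => F t (z.1 t)) t)
        (periodicSolution μ (fun t => F t (w.1 t)) t) ≤ _
      rw [dist_eq_norm, periodicSolution_sub μ (hgc z) (hgc w)]
      refine (norm_periodicSolution_le hμ hc hcμ (M := K * dist z.1 w.1) (fun t => ?_) t).trans_eq
        (by ring)
      refine (hL t _ _ (z.2.1 t) (w.2.1 t)).trans ?_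
      rw [← dist_eq_norm]
      gcongr
      exact BoundedContinuousFunction.dist_coe_le_dist t
  let z := ContractingWith.fixedPoint T hT
  have hz : (z.1 : ℝ → ℂ) = periodicSolution μ fun t => F t (z.1 t) := by
    have : T z = z := hT.fixedPoint_isFixedPt
    exact (congrArg (fun w : S => (w.1 : ℝ → ℂ)) this).symm
  refine ⟨z.1, z.2.1, z.2.2, fun t => ?_⟩
  have := hderiv z t
  rwa [← hz] at this

theorem le_norm_exp_sub_one {μ : ℂ} (hμ : 0 < μ.re) (hμ' : μ.re ≤ 1 / 2) :
    2 * Real.pi * μ.re / 5 ≤ ‖Complex.exp (-μ * (2 * Real.pi : ℝ)) - 1‖ := by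
  have hpi := Real.pi_pos
  have hpi4 := Real.pi_le_four
  set x := 2 * Real.pi * μ.re with hx
  have hx0 : 0 < x := by positivity
  have hx4 : x ≤ 4 := by nlinarith
  have h1 : ‖Complex.exp (-μ * (2 * Real.pi : ℝ))‖ = Real.exp (-x) := by
    rw [Complex.norm_exp]
    congr 1
    simp only [Complex.mul_re, Complex.neg_re, Complex.ofReal_re, Complex.ofReal_im, mul_zero,
      sub_zero, hx]
    ring
  have h2 : Real.exp (-x) ≤ 1 - x / 5 := by
    rw [Real.exp_neg]
    refine inv_le_of_inv_le₀ (by linarith) ?_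
    refine le_trans ?_ (Real.add_one_le_exp x)
    rw [inv_le_iff_one_le_mul₀ (by linarith)]
    nlinarith
  have h3 := norm_sub_norm_le (1 : ℂ) (Complex.exp (-μ * (2 * Real.pi : ℝ)))
  rw [norm_one, h1, norm_sub_rev] at h3
  linarith

/-- Small nonlinear perturbations of `u'' = 2 κ u' - u` have small `2π`-periodic solutions. -/
theorem exists_periodic_oscillation {κ R M K : ℝ} (hκ : 0 < κ) (hκ' : κ ≤ 1 / 2) (hR : 0 ≤ R)
    (hK : 0 ≤ K) {f : ℝ → ℝ → ℝ → ℝ} (hf : Continuous fun p : ℝ × ℝ × ℝ => f p.1 p.2.1 p.2.2)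
    (hper : ∀ t u v, f (t + 2 * Real.pi) u v = f t u v)
    (hM : ∀ t u v, |u| ≤ 2 * R → |v| ≤ 2 * R → |f t u v| ≤ M)
    (hL : ∀ t u v u' v' δ, |u| ≤ 2 * R → |v| ≤ 2 * R → |u'| ≤ 2 * R → |v'| ≤ 2 * R →
      |u - u'| ≤ δ → |v - v'| ≤ δ → |f t u v - f t u' v'| ≤ K * δ)
    (hMR : 5 * M ≤ κ * R) (hKc : 10 * K < κ) :
    ∃ u v : ℝ → ℝ, (∀ t, |u t| ≤ 2 * R) ∧ (∀ t, |v t| ≤ 2 * R) ∧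
      (∀ t, u (t + 2 * Real.pi) = u t) ∧ (∀ t, v (t + 2 * Real.pi) = v t) ∧
      (∀ t, HasDerivAt u (v t) t) ∧
      ∀ t, HasDerivAt v (2 * κ * v t - u t + f t (u t) (v t)) t := by
  have hpi := Real.pi_pos
  obtain ⟨ω, hω, hω2⟩ : ∃ ω : ℝ, 1 / 2 ≤ ω ∧ ω ^ 2 = 1 - κ ^ 2 := by
    refine ⟨√(1 - κ ^ 2), ?_, Real.sq_sqrt (by nlinarith)⟩
    exact Real.le_sqrt_of_sq_le (by nlinarith)
  have hω0 : 0 < ω := by linarith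
  let U : ℂ → ℝ := fun z => z.im / ω
  let V : ℂ → ℝ := fun z => z.re + κ * (z.im / ω)
  have hU : ∀ z, |U z| ≤ 2 * ‖z‖ := by
    intro z
    simp only [U]
    rw [abs_div, abs_of_pos hω0, div_le_iff₀ hω0]
    nlinarith [Complex.abs_im_le_norm z, norm_nonneg z]
  have hV : ∀ z, |V z| ≤ 2 * ‖z‖ := by
    intro z
    have h1 : |κ * U z| ≤ ‖z‖ := by
      rw [abs_mul, abs_of_pos hκ]
      nlinarith [hU z, abs_nonneg (U z)]
    have := abs_add_le z.re (κ * U z)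
    change |z.re + κ * U z| ≤ _
    linarith [Complex.abs_re_le_norm z]
  have hUs : ∀ z w, U z - U w = U (z - w) := by
    intro z w
    simp only [U, Complex.sub_im]
    ring
  have hVs : ∀ z w, V z - V w = V (z - w) := by
    intro z w
    simp only [V, Complex.sub_im, Complex.sub_re]
    ring
  have hUc : Continuous U := by fun_prop
  have hVc : Continuous V := by fun_prop
  have hle : ∀ z : ℂ, ‖z‖ ≤ R → |U z| ≤ 2 * R ∧ |V z| ≤ 2 * R := fun z hz =>
    ⟨(hU z).trans (by linarith), (hV z).trans (by linarith)⟩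
  obtain ⟨z, hzR, hzp, hz⟩ := exists_periodic_solution (μ := ⟨κ, ω⟩)
    (F := fun t z => ((f t (U z) (V z) : ℝ) : ℂ)) (M := M) (K := 2 * K) (R := R)
    hκ.le (c := 2 * Real.pi * κ / 5) (by positivity)
    (le_norm_exp_sub_one (μ := ⟨κ, ω⟩) hκ hκ') hR (by positivity)
    (Complex.continuous_ofReal.comp (hf.comp (continuous_fst.prodMk
      ((hUc.comp continuous_snd).prodMk (hVc.comp continuous_snd)))))
    (fun t z => by rw [hper])
    (fun t z hz => by
      rw [Complex.norm_real]
      exact hM _ _ _ (hle z hz).1 (hle z hz).2)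
    (fun t z w hz hw => by
      rw [← Complex.ofReal_sub, Complex.norm_real, mul_comm 2 K, mul_assoc]
      refine hL _ _ _ _ _ _ (hle z hz).1 (hle z hz).2 (hle w hw).1 (hle w hw).2 ?_ ?_
      · rw [hUs]
        exact hU _
      · rw [hVs]
        exact hV _)
    (by nlinarith) (by nlinarith)
  have hre : ∀ t, HasDerivAt (fun t => (z t).re)
      (κ * (z t).re - ω * (z t).im + f t (U (z t)) (V (z t))) t := by
    intro t
    have := Complex.reCLM.hasFDerivAt.comp_hasDerivAt t (hz t)
    exact this.congr_deriv (by simp)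
  have him : ∀ t, HasDerivAt (fun t => U (z t)) (V (z t)) t := by
    intro t
    have := (Complex.imCLM.hasFDerivAt.comp_hasDerivAt t (hz t)).div_const ω
    refine this.congr_deriv ?_
    simp [V]
    field_simp
    ring
  refine ⟨fun t => U (z t), fun t => V (z t), fun t => (hle _ (hzR t)).1,
    fun t => (hle _ (hzR t)).2, fun t => by simp only [hzp], fun t => by simp only [hzp],
    him, fun t => ?_⟩
  refine ((hre t).add ((him t).const_mul κ)).congr_deriv ?_
  have hVU : V (z t) = (z t).re + κ * U (z t) := rfl
  have him' : (z t).im = ω * U (z t) := by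
    simp only [U]
    field_simp
  rw [him', show (z t).re = V (z t) - κ * U (z t) by rw [hVU]; ring]
  linear_combination (-U (z t)) * hω2

/-- A `C¹` function of three variables is bounded and Lipschitz on cubes. -/
theorem exists_bound_and_lipschitz {P : ℝ × ℝ × ℝ → ℝ} (hP : ContDiff ℝ 1 P) (S : ℝ) :
    ∃ B : ℝ, 0 ≤ B ∧ (∀ p, ‖p‖ ≤ S → |P p| ≤ B) ∧
      ∀ p q, ‖p‖ ≤ S → ‖q‖ ≤ S → |P p - P q| ≤ B * ‖p - q‖ := by
  have hc : IsCompact (Metric.closedBall (0 : ℝ × ℝ × ℝ) S) := isCompact_closedBall _ _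
  obtain ⟨B, hB⟩ := hc.exists_bound_of_continuousOn hP.continuous.continuousOn
  obtain ⟨K, hK⟩ := hP.contDiffOn.exists_lipschitzOnWith one_ne_zero
    (convex_closedBall (0 : ℝ × ℝ × ℝ) S) hc
  refine ⟨max B K, K.2.trans (le_max_right _ _), fun p hp => ?_, fun p q hp hq => ?_⟩
  · exact (hB p (by simpa using hp)).trans (le_max_left _ _)
  · have := hK.dist_le_mul p (by simpa using hp) q (by simpa using hq)
    rw [dist_eq_norm, dist_eq_norm] at this
    exact this.trans (by gcongr; exact le_max_right _ _)


/-- Theorem 4 of the paper, in the rescaled variables.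
For `(x, y, ρ, δ, α, λ) = (εX, εY, εr, ε²d, ε^{n₂}a, ε^{n₃}ℓ)` with `ρ ≠ 0`, the
rescaled system has a `2π`-periodic solution whose initial condition tends to
`(0, −d/r)` as `ε → 0⁺`. -/
theorem stmt_3 (r d a l : ℝ) (n₂ n₃ : ℕ)
    (hr : 0 < r) (hd : 0 < d) (hn₂ : 0 < n₂) (hn₃ : 0 < n₃) (hl : l ≠ 0) :
    ∃ ε₀ > (0 : ℝ), ∃ X Y : ℝ → ℝ → ℝ,
      (∀ ε ∈ Set.Ioo (0 : ℝ) ε₀,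
        (∀ t, HasDerivAt (X ε) (Y ε t) t) ∧
        (∀ t, HasDerivAt (Y ε)
          (-(X ε t) + ε * r * Y ε t - ε ^ 3 * r * (X ε t) ^ 2 * Y ε t
            - ε ^ (n₂ + 2) * a * (X ε t) ^ 3 - ε ^ (n₃ + 4) * l * (X ε t) ^ 5
            + ε * d * Real.cos t) t) ∧
        (∀ t, X ε (t + 2 * Real.pi) = X ε t) ∧
        (∀ t, Y ε (t + 2 * Real.pi) = Y ε t)) ∧
      Filter.Tendsto (fun ε => (X ε 0, Y ε 0)) (nhdsWithin 0 (Set.Ioi 0))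
        (nhds ((0 : ℝ), -d / r)) := by
  obtain ⟨m, rfl⟩ : ∃ m, n₂ = m + 1 := ⟨n₂ - 1, by omega⟩
  let P : ℝ × ℝ × ℝ → ℝ := fun p =>
    r * p.2.1 ^ 2 * p.2.2 + p.1 ^ m * a * p.2.1 ^ 3 + p.1 ^ (n₃ + 1) * l * p.2.1 ^ 5
  have hP : ContDiff ℝ 1 P := by fun_prop
  obtain ⟨B, hB0, hB, hBL⟩ := exists_bound_and_lipschitz hP (d / r + 2)
  have hdr : 0 < d / r := by positivity
  have hsin : ∀ t, |-(d / r) * Real.sin t| ≤ d / r := fun t => by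
    rw [abs_mul, abs_neg, abs_of_pos hdr]
    nlinarith [Real.abs_sin_le_one t]
  have hcos : ∀ t, |-(d / r) * Real.cos t| ≤ d / r := fun t => by
    rw [abs_mul, abs_neg, abs_of_pos hdr]
    nlinarith [Real.abs_cos_le_one t]
  let ε₀ : ℝ := min 1 (min (1 / r) (r / (20 * (B + 1))))
  have hex : ∀ ε : ℝ, ∃ u v : ℝ → ℝ, ε ∈ Set.Ioo 0 ε₀ →
      (∀ t, |u t| ≤ 2 * ε) ∧ (∀ t, |v t| ≤ 2 * ε) ∧
      (∀ t, u (t + 2 * Real.pi) = u t) ∧ (∀ t, v (t + 2 * Real.pi) = v t) ∧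
      (∀ t, HasDerivAt u (v t) t) ∧
      ∀ t, HasDerivAt v (2 * (ε * r / 2) * v t - u t + -ε ^ 3 *
        P (ε, -(d / r) * Real.sin t + u t, -(d / r) * Real.cos t + v t)) t := by
    intro ε
    by_cases hε : ε ∈ Set.Ioo 0 ε₀
    swap
    · exact ⟨0, 0, fun h => absurd h hε⟩
    obtain ⟨hε0, hεlt⟩ := hε
    simp only [ε₀, lt_min_iff] at hεlt
    obtain ⟨hε1, hεr, hεB⟩ := hεlt
    rw [lt_div_iff₀ hr] at hεr
    rw [lt_div_iff₀ (by positivity)] at hεB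
    have hBε : 20 * (ε * B) < r := by nlinarith
    have hBε2 : 20 * (ε ^ 2 * B) < r := by nlinarith [mul_nonneg hε0.le hB0]
    have hnorm : ∀ t u v, |u| ≤ 2 * ε → |v| ≤ 2 * ε →
        ‖(ε, -(d / r) * Real.sin t + u, -(d / r) * Real.cos t + v)‖ ≤ d / r + 2 := by
      intro t u v hu hv
      simp only [Prod.norm_mk, Real.norm_eq_abs]
      refine max_le ?_ (max_le ?_ ?_)
      · rw [abs_of_pos hε0]
        linarith
      · exact (abs_add_le _ _).trans (by linarith [hsin t])
      · exact (abs_add_le _ _).trans (by linarith [hcos t])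
    have hε3 : |-ε ^ 3| = ε ^ 3 := by rw [abs_neg, abs_of_pos (by positivity)]
    obtain ⟨u, v, h⟩ := exists_periodic_oscillation (κ := ε * r / 2) (R := ε) (M := ε ^ 3 * B)
      (K := ε ^ 3 * B) (f := fun t u v => -ε ^ 3 *
        P (ε, -(d / r) * Real.sin t + u, -(d / r) * Real.cos t + v))
      (by positivity) (by linarith) hε0.le (by positivity)
      (by
        have := hP.continuous
        fun_prop)
      (fun t u v => by simp only [Real.sin_add_two_pi, Real.cos_add_two_pi])
      (fun t u v hu hv => by
        rw [abs_mul, hε3]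
        gcongr
        exact hB _ (hnorm t u v hu hv))
      (fun t u v u' v' δ hu hv hu' hv' h₁ h₂ => by
        rw [← mul_sub, abs_mul, hε3, mul_assoc]
        gcongr
        refine (hBL _ _ (hnorm t u v hu hv) (hnorm t u' v' hu' hv')).trans ?_
        gcongr
        simp only [Prod.mk_sub_mk, Prod.norm_mk, Real.norm_eq_abs, sub_self, abs_zero,
          add_sub_add_left_eq_sub]
        exact max_le ((abs_nonneg _).trans h₁) (max_le h₁ h₂))
      (by nlinarith [mul_pos hε0 hε0])
      (by nlinarith)
    exact ⟨u, v, fun _ => h⟩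
  choose u v huv using hex
  have hε₀ : 0 < ε₀ := by positivity
  refine ⟨ε₀, hε₀, fun ε t => -(d / r) * Real.sin t + u ε t,
    fun ε t => -(d / r) * Real.cos t + v ε t, fun ε hε => ?_, ?_⟩
  · obtain ⟨-, -, hup, hvp, hu', hv'⟩ := huv ε hε
    refine ⟨fun t => ((Real.hasDerivAt_sin t).const_mul _).add (hu' t), fun t => ?_,
      fun t => by simp only [Real.sin_add_two_pi, hup],
      fun t => by simp only [Real.cos_add_two_pi, hvp]⟩
    refine (((Real.hasDerivAt_cos t).const_mul (-(d / r))).add (hv' t)).congr_deriv ?_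
    have hd' : d = r * (d / r) := by field_simp
    simp only [P]
    generalize d / r = A at *
    rw [hd']
    ring
  · have hsmall : ∀ w : ℝ → ℝ → ℝ, (∀ ε ∈ Set.Ioo 0 ε₀, |w ε 0| ≤ 2 * ε) →
        Filter.Tendsto (fun ε => w ε 0) (nhdsWithin 0 (Set.Ioi 0)) (nhds 0) := by
      intro w hw
      refine squeeze_zero_norm' (a := fun ε => 2 * ε) ?_ ?_
      · filter_upwards [Ioo_mem_nhdsGT hε₀] with ε hε using hw ε hε
      · have : Continuous fun ε : ℝ => 2 * ε := by fun_prop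
        simpa using (this.tendsto 0).mono_left nhdsWithin_le_nhds
    have h₁ := hsmall u fun ε hε => (huv ε hε).1 0
    have h₂ := hsmall v fun ε hε => (huv ε hε).2.1 0
    refine Filter.Tendsto.prodMk_nhds ?_ ?_
    · simpa using h₁
    · simpa [neg_div] using h₂.const_add (-(d / r))
end
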